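/- Let β∈(0,1), s=s₁=1, and let u be three times continuously differentiable on [a,b]. Then there exist constants C₁,C₂>0, possibly depending on a, b, β, λ, g and the values of u, u′, u″, u‴ on [a,b], but independent of M and h, such that for every integer M≥3 the linear system H U_h = F has a unique solution U_h and ‖U−U_h‖ ≤ C₁ h² and ‖U−U_h‖_∞ ≤ C₂ h². -/

import Mathlib

open MeasureTheory Set

noncomputable section

/-- Grid spacing `h = (b−a)/(M+1)`. -/
def gH (a b : ℝ) (M : ℕ) : ℝ := (b - a) / (M + 1)

/-- Grid points `x_i = a + i h`, `i = 0,…,M+1`. -/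
def gX (a b : ℝ) (M i : ℕ) : ℝ := a + i * gH a b M

/-- `A₁(i,s,k) = h^{−s−1} ∫_{x_{k−1}}^{x_k} (x_k−y)(x_i−y)^{s−1−β} dy`. -/
def cA1 (a b β : ℝ) (s M i k : ℕ) : ℝ :=
  gH a b M ^ (-(s : ℝ) - 1) *
    ∫ y in gX a b M (k - 1)..gX a b M k,
      (gX a b M k - y) * (gX a b M i - y) ^ ((s : ℝ) - 1 - β)

/-- `A₂(i,s,k) = h^{−s−1} ∫_{x_{k−1}}^{x_k} (y−x_{k−1})(x_i−y)^{s−1−β} dy`. -/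
def cA2 (a b β : ℝ) (s M i k : ℕ) : ℝ :=
  gH a b M ^ (-(s : ℝ) - 1) *
    ∫ y in gX a b M (k - 1)..gX a b M k,
      (y - gX a b M (k - 1)) * (gX a b M i - y) ^ ((s : ℝ) - 1 - β)

/-- `A₃(i,s,k) = h^{−s−1} ∫_{x_{k−1}}^{x_k} (x_k−y)(y−x_i)^{s−1−β} dy`. -/
def cA3 (a b β : ℝ) (s M i k : ℕ) : ℝ :=
  gH a b M ^ (-(s : ℝ) - 1) *
    ∫ y in gX a b M (k - 1)..gX a b M k,
      (gX a b M k - y) * (y - gX a b M i) ^ ((s : ℝ) - 1 - β)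

/-- `A₄(i,s,k) = h^{−s−1} ∫_{x_{k−1}}^{x_k} (y−x_{k−1})(y−x_i)^{s−1−β} dy`. -/
def cA4 (a b β : ℝ) (s M i k : ℕ) : ℝ :=
  gH a b M ^ (-(s : ℝ) - 1) *
    ∫ y in gX a b M (k - 1)..gX a b M k,
      (y - gX a b M (k - 1)) * (y - gX a b M i) ^ ((s : ℝ) - 1 - β)

/-- `B₁(i) = ∫_{−∞}^a e^{λ(y−x_i)} (x_i−y)^{−1−β} dy`. -/
def cB1 (a b β lam : ℝ) (M i : ℕ) : ℝ :=
  ∫ y in Iio a, Real.exp (lam * (y - gX a b M i)) * (gX a b M i - y) ^ (-1 - β)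

/-- `B₂(i) = ∫_b^∞ e^{λ(x_i−y)} (y−x_i)^{−1−β} dy`. -/
def cB2 (a b β lam : ℝ) (M i : ℕ) : ℝ :=
  ∫ y in Ioi b, Real.exp (lam * (gX a b M i - y)) * (y - gX a b M i) ^ (-1 - β)

/-- Off-diagonal entries `h_{i,j}` (in 1-based indexing, `1 ≤ i,j ≤ M`, `i ≠ j`) of the
stiffness matrix. -/
def offD (a b β lam : ℝ) (s s₁ M i j : ℕ) : ℝ :=
  if j + 2 ≤ i then
    -((cA1 a b β s M i (j + 1) + cA2 a b β s M i j) *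
        Real.exp (-lam * ((i : ℝ) - j) * gH a b M) * ((i : ℝ) - j) ^ (-(s : ℝ)))
  else if j + 1 = i then
    -(gH a b M ^ (-β) * Real.exp (-lam * gH a b M) / ((s₁ : ℝ) + 1 - β))
      - cA2 a b β s M i (i - 1) * Real.exp (-lam * gH a b M)
  else if j = i + 1 then
    -(gH a b M ^ (-β) * Real.exp (-lam * gH a b M) / ((s₁ : ℝ) + 1 - β))
      - cA3 a b β s M i (i + 2) * Real.exp (-lam * gH a b M)
  else if i + 2 ≤ j then
    -((cA3 a b β s M i (j + 1) + cA4 a b β s M i j) *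
        Real.exp (-lam * ((j : ℝ) - i) * gH a b M) * ((j : ℝ) - i) ^ (-(s : ℝ)))
  else 0

/-- The prescribed value of `h_{i,i} + Σ_{j≠i} h_{i,j} − B₁(i) − B₂(i)` (1-based index `i`). -/
def diagExtra (a b β lam : ℝ) (s s₁ M i : ℕ) : ℝ :=
  if i = 1 then
    gH a b M ^ (-β) * Real.exp (-lam * gH a b M) / ((s₁ : ℝ) + 1 - β)
      + cA4 a b β s M 1 (M + 1) * Real.exp (-lam * M * gH a b M) * (M : ℝ) ^ (-(s : ℝ))
  else if i = M then
    gH a b M ^ (-β) * Real.exp (-lam * gH a b M) / ((s₁ : ℝ) + 1 - β)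
      + cA1 a b β s M M 1 * Real.exp (-lam * M * gH a b M) * (M : ℝ) ^ (-(s : ℝ))
  else
    cA1 a b β s M i 1 * Real.exp (-lam * i * gH a b M) * (i : ℝ) ^ (-(s : ℝ))
      + cA4 a b β s M i (M + 1) * Real.exp (-lam * ((M : ℝ) + 1 - i) * gH a b M) *
          ((M : ℝ) + 1 - i) ^ (-(s : ℝ))

/-- The `M×M` stiffness matrix `H = (h_{i,j})`: off-diagonal entries given by `offD`, and
diagonal entries defined so that
`h_{i,i} + Σ_{j≠i} h_{i,j} − B₁(i) − B₂(i) = diagExtra i`. -/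
def stiff (a b β lam : ℝ) (s s₁ M : ℕ) : Matrix (Fin M) (Fin M) ℝ :=
  fun i j =>
    if i = j then
      cB1 a b β lam M (i.val + 1) + cB2 a b β lam M (i.val + 1)
        + diagExtra a b β lam s s₁ M (i.val + 1)
        - ∑ k ∈ Finset.univ.erase i, offD a b β lam s s₁ M (i.val + 1) (k.val + 1)
    else offD a b β lam s s₁ M (i.val + 1) (j.val + 1)

/-- `d₁(i) = ∫_{−∞}^a g(y) e^{−λ(x_i−y)} (x_i−y)^{−1−β} dy`. -/
def dd1 (a b β lam : ℝ) (g : ℝ → ℝ) (M i : ℕ) : ℝ :=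
  ∫ y in Iio a, g y * Real.exp (-lam * (gX a b M i - y)) * (gX a b M i - y) ^ (-1 - β)

/-- `d₂(i) = ∫_b^∞ g(y) e^{−λ(y−x_i)} (y−x_i)^{−1−β} dy`. -/
def dd2 (a b β lam : ℝ) (g : ℝ → ℝ) (M i : ℕ) : ℝ :=
  ∫ y in Ioi b, g y * Real.exp (-lam * (y - gX a b M i)) * (y - gX a b M i) ^ (-1 - β)

/-- The load vector `F`. -/
def loadF (a b β lam : ℝ) (s s₁ : ℕ) (f g u : ℝ → ℝ) (M : ℕ) : Fin M → ℝ :=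
  fun i =>
    f (gX a b M (i.val + 1)) + dd1 a b β lam g M (i.val + 1) + dd2 a b β lam g M (i.val + 1)
      + (if i.val + 1 = 1 then
            gH a b M ^ (-β) * Real.exp (-lam * gH a b M) / ((s₁ : ℝ) + 1 - β)
          else
            cA1 a b β s M (i.val + 1) 1 * Real.exp (-lam * ((i.val : ℝ) + 1) * gH a b M) *
              ((i.val : ℝ) + 1) ^ (-(s : ℝ))) * u a
      + (if i.val + 1 = M then
            gH a b M ^ (-β) * Real.exp (-lam * gH a b M) / ((s₁ : ℝ) + 1 - β)
          else
            cA4 a b β s M (i.val + 1) (M + 1) *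
              Real.exp (-lam * ((M : ℝ) - i.val) * gH a b M) *
              ((M : ℝ) - (i.val : ℝ)) ^ (-(s : ℝ))) * u b

/-- The discrete `L²` norm `‖v‖ = (h Σᵢ vᵢ²)^{1/2}`. -/
def dnorm2 (a b : ℝ) (M : ℕ) (v : Fin M → ℝ) : ℝ :=
  Real.sqrt (gH a b M * ∑ i, v i ^ 2)

end

noncomputable section

open MeasureTheory Set Filter

theorem exists_hasDerivAt_extension {a b : ℝ} {u w W : ℝ → ℝ}
    (hu : ∀ x ∈ Icc a b, HasDerivWithinAt u (w x) (Icc a b) x)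
    (hW : Continuous W) (hWw : EqOn W w (Icc a b)) :
    ∃ U : ℝ → ℝ, (∀ x, HasDerivAt U (W x) x) ∧ EqOn U u (Icc a b) := by
  refine ⟨fun x => u a + ∫ t in a..x, W t, fun x => ?_, fun x hx => ?_⟩
  · exact (intervalIntegral.integral_hasDerivAt_right (hW.intervalIntegrable _ _)
      hW.stronglyMeasurable.stronglyMeasurableAtFilter hW.continuousAt).const_add _
  · have hsub : Icc a x ⊆ Icc a b := Icc_subset_Icc le_rfl hx.2
    have key : ∫ t in a..x, W t = u x - u a := by
      refine intervalIntegral.integral_eq_sub_of_hasDeriv_right_of_le hx.1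
        (fun y hy => ((hu y (hsub hy)).continuousWithinAt).mono hsub) (fun y hy => ?_)
        (hW.intervalIntegrable _ _)
      have hyb : y ∈ Ioo a b := ⟨hy.1, hy.2.trans_le hx.2⟩
      rw [hWw (Ioo_subset_Icc_self hyb)]
      exact ((hu y (Ioo_subset_Icc_self hyb)).hasDerivAt (Icc_mem_nhds hyb.1 hyb.2)).hasDerivWithinAt
    simp only [key]; ring

theorem exists_C3_extension {a b : ℝ} (hab : a < b) {u : ℝ → ℝ}
    (hu : ContDiffOn ℝ 3 u (Icc a b)) :
    ∃ U U₁ U₂ U₃ : ℝ → ℝ, (∀ x, HasDerivAt U (U₁ x) x) ∧ (∀ x, HasDerivAt U₁ (U₂ x) x) ∧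
      (∀ x, HasDerivAt U₂ (U₃ x) x) ∧ Continuous U₃ ∧ EqOn U u (Icc a b) := by
  have hs := uniqueDiffOn_Icc hab
  have step : ∀ n : ℕ, n < 3 → ∀ x ∈ Icc a b, HasDerivWithinAt
      (iteratedDerivWithin n u (Icc a b)) (iteratedDerivWithin (n + 1) u (Icc a b) x)
      (Icc a b) x := by
    intro n hn x hx
    rw [iteratedDerivWithin_succ]
    exact (hu.differentiableOn_iteratedDerivWithin (by exact_mod_cast hn) hs x hx).hasDerivWithinAt
  have hc : ContinuousOn (iteratedDerivWithin 3 u (Icc a b)) (Icc a b) :=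
    hu.continuousOn_iteratedDerivWithin (by norm_num) hs
  set U₃ : ℝ → ℝ := IccExtend hab.le ((Icc a b).domRestrict (iteratedDerivWithin 3 u (Icc a b)))
  have hU₃ : Continuous U₃ := (continuousOn_iff_continuous_domRestrict.1 hc).Icc_extend'
  have hE₃ : EqOn U₃ (iteratedDerivWithin 3 u (Icc a b)) (Icc a b) := fun x hx =>
    IccExtend_of_mem hab.le _ hx
  obtain ⟨U₂, h₂, e₂⟩ := exists_hasDerivAt_extension (step 2 (by norm_num)) hU₃ hE₃
  have c₂ : Continuous U₂ := continuous_iff_continuousAt.2 fun x => (h₂ x).continuousAt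
  obtain ⟨U₁, h₁, e₁⟩ := exists_hasDerivAt_extension (step 1 (by norm_num)) c₂ e₂
  have c₁ : Continuous U₁ := continuous_iff_continuousAt.2 fun x => (h₁ x).continuousAt
  obtain ⟨U, h₀, e₀⟩ := exists_hasDerivAt_extension (step 0 (by norm_num)) c₁ e₁
  exact ⟨U, U₁, U₂, U₃, h₀, h₁, h₂, hU₃, by simpa using e₀⟩

theorem abs_sub_sub_mul_le {φ φ' φ'' : ℝ → ℝ} {c d K : ℝ}
    (h1 : ∀ x, HasDerivAt φ (φ' x) x) (h2 : ∀ x, HasDerivAt φ' (φ'' x) x)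
    (hK : ∀ x ∈ Icc c d, |φ'' x| ≤ K) {x y : ℝ} (hx : x ∈ Icc c d) (hy : y ∈ Icc c d) :
    |φ y - φ x - φ' x * (y - x)| ≤ K * |y - x| ^ 2 := by
  have hsub : uIcc x y ⊆ Icc c d := (convex_Icc c d).ordConnected.uIcc_subset hx hy
  have hK0 : 0 ≤ K := (abs_nonneg _).trans (hK x hx)
  have hb : ∀ z ∈ uIcc x y, ‖φ' z - φ' x‖ ≤ K * |y - x| := by
    intro z hz
    have := (convex_uIcc x y).norm_image_sub_le_of_norm_hasDerivWithin_le
      (fun w _ => (h2 w).hasDerivWithinAt) (fun w hw => hK w (hsub hw)) left_mem_uIcc hz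
    refine this.trans ?_
    gcongr
    rw [Real.norm_eq_abs]
    exact abs_sub_left_of_mem_uIcc hz
  have := (convex_uIcc x y).norm_image_sub_le_of_norm_hasDerivWithin_le
      (f := fun z => φ z - φ' x * (z - x)) (f' := fun z => φ' z - φ' x)
      (fun w _ => by
        refine HasDerivAt.hasDerivWithinAt (HasDerivAt.congr_deriv
          ((h1 w).sub (((hasDerivAt_id w).sub_const x).const_mul (φ' x))) (by simp))) hb left_mem_uIcc right_mem_uIcc
  simp only [Real.norm_eq_abs] at this
  calc _ = |φ y - φ' x * (y - x) - (φ x - φ' x * (x - x))| := by congr 1; ring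
    _ ≤ _ := this
    _ = _ := by ring

theorem abs_taylor_second_le {φ φ' φ'' φ''' : ℝ → ℝ} {c d K : ℝ}
    (h1 : ∀ x, HasDerivAt φ (φ' x) x) (h2 : ∀ x, HasDerivAt φ' (φ'' x) x)
    (h3 : ∀ x, HasDerivAt φ'' (φ''' x) x)
    (hK : ∀ x ∈ Icc c d, |φ''' x| ≤ K) {x y : ℝ} (hx : x ∈ Icc c d) (hy : y ∈ Icc c d) :
    |φ y - φ x - φ' x * (y - x) - φ'' x * (y - x) ^ 2 / 2| ≤ K * |y - x| ^ 3 := by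
  have hsub : uIcc x y ⊆ Icc c d := (convex_Icc c d).ordConnected.uIcc_subset hx hy
  have hK0 : 0 ≤ K := (abs_nonneg _).trans (hK x hx)
  have hb : ∀ z ∈ uIcc x y, ‖φ' z - φ' x - φ'' x * (z - x)‖ ≤ K * |y - x| ^ 2 := by
    intro z hz
    refine (abs_sub_sub_mul_le h2 h3 hK hx (hsub hz)).trans ?_
    gcongr K * ?_ ^ 2
    exact abs_sub_left_of_mem_uIcc hz
  have := (convex_uIcc x y).norm_image_sub_le_of_norm_hasDerivWithin_le
      (f := fun z => φ z - φ' x * (z - x) - φ'' x * (z - x) ^ 2 / 2)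
      (f' := fun z => φ' z - φ' x - φ'' x * (z - x))
      (fun w _ => by
        refine HasDerivAt.hasDerivWithinAt (HasDerivAt.congr_deriv
          (((h1 w).sub (((hasDerivAt_id w).sub_const x).const_mul (φ' x))).sub
          (((((hasDerivAt_id w).sub_const x).pow 2).const_mul (φ'' x)).div_const 2)) ?_)
        simp only [id, mul_one, Nat.cast_ofNat]
        ring) hb left_mem_uIcc right_mem_uIcc
  simp only [Real.norm_eq_abs] at this
  calc _ = |φ y - φ' x * (y - x) - φ'' x * (y - x) ^ 2 / 2
            - (φ x - φ' x * (x - x) - φ'' x * (x - x) ^ 2 / 2)| := by congr 1; ring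
    _ ≤ _ := this
    _ = _ := by ring

/-- Error bound for linear interpolation, multiplied by the length of the interval. -/
theorem abs_interpolation_error_le {φ φ' φ'' : ℝ → ℝ} {c d K : ℝ}
    (h1 : ∀ x, HasDerivAt φ (φ' x) x) (h2 : ∀ x, HasDerivAt φ' (φ'' x) x)
    (hK : ∀ x ∈ Icc c d, |φ'' x| ≤ K) {x : ℝ} (hx : x ∈ Icc c d) :
    |(d - c) * φ x - (d - x) * φ c - (x - c) * φ d| ≤ K * (d - c) ^ 3 := by
  have hcd : c ≤ d := hx.1.trans hx.2
  have hK0 : 0 ≤ K := (abs_nonneg _).trans (hK x hx)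
  have e1 := abs_sub_sub_mul_le h1 h2 hK hx (left_mem_Icc.2 hcd)
  have e2 := abs_sub_sub_mul_le h1 h2 hK hx (right_mem_Icc.2 hcd)
  rw [sq_abs] at e1 e2
  set E1 := φ c - φ x - φ' x * (c - x)
  set E2 := φ d - φ x - φ' x * (d - x)
  have hx1 := sub_nonneg.2 hx.1
  have hx2 := sub_nonneg.2 hx.2
  calc |(d - c) * φ x - (d - x) * φ c - (x - c) * φ d|
      = |-((d - x) * E1 + (x - c) * E2)| := by congr 1; simp only [E1, E2]; ring
    _ ≤ |(d - x) * E1| + |(x - c) * E2| := by rw [abs_neg]; exact abs_add_le _ _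
    _ = (d - x) * |E1| + (x - c) * |E2| := by
        rw [abs_mul, abs_mul, abs_of_nonneg hx1, abs_of_nonneg hx2]
    _ ≤ (d - x) * (K * (c - x) ^ 2) + (x - c) * (K * (d - x) ^ 2) := by gcongr
    _ = K * ((d - x) * (x - c) * (d - c)) := by ring
    _ ≤ K * ((d - c) * (d - c) * (d - c)) := by gcongr <;> linarith
    _ = K * (d - c) ^ 3 := by ring

/-- The difference quotient `(p(0) − p(r)) e^{−λr} / r` has a linear interpolation error of second
order, uniformly up to `r = 0`. -/
theorem abs_quotient_interpolation_error_le {p p₁ p₂ p₃ : ℝ → ℝ} {L K lam c d : ℝ}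
    (h1 : ∀ x, HasDerivAt p (p₁ x) x) (h2 : ∀ x, HasDerivAt p₁ (p₂ x) x)
    (h3 : ∀ x, HasDerivAt p₂ (p₃ x) x) (hlam : 0 ≤ lam)
    (hK1 : ∀ x ∈ Icc 0 L, |p₁ x| ≤ K) (hK2 : ∀ x ∈ Icc 0 L, |p₂ x| ≤ K)
    (hK3 : ∀ x ∈ Icc 0 L, |p₃ x| ≤ K) (hc : 0 < c) (hd : d ≤ L) {x : ℝ} (hx : x ∈ Icc c d) :
    |(d - c) * ((p 0 - p x) * Real.exp (-lam * x) / x)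
        - (d - x) * ((p 0 - p c) * Real.exp (-lam * c) / c)
        - (x - c) * ((p 0 - p d) * Real.exp (-lam * d) / d)| ≤
      K * (1 + lam) ^ 2 * (d - c) ^ 3 := by
  have hcd : c ≤ d := hx.1.trans hx.2
  have c1 : Continuous p₁ := continuous_iff_continuousAt.2 fun x => (h2 x).continuousAt
  have rep : ∀ r, 0 < r → (p 0 - p r) * Real.exp (-lam * r) / r
      = -∫ t in (0:ℝ)..1, p₁ (t * r) * Real.exp (-lam * r) := by
    intro r hr
    have : ∫ t in (0:ℝ)..1, p₁ (t * r) * r = p (1 * r) - p (0 * r) := by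
      refine intervalIntegral.integral_eq_sub_of_hasDerivAt (f := fun t => p (t * r))
        (fun t _ => ?_) (by apply Continuous.intervalIntegrable; fun_prop)
      exact ((h1 (t * r)).comp t ((hasDerivAt_id t).mul_const r)).congr_deriv (by simp)
    rw [intervalIntegral.integral_mul_const] at this ⊢
    have e : p 0 - p r = -((∫ t in (0:ℝ)..1, p₁ (t * r)) * r) := by rw [this]; simp
    rw [e, neg_mul, neg_div, mul_right_comm, mul_div_assoc, div_self hr.ne', mul_one]
  rw [rep x (hc.trans_le hx.1), rep c hc, rep d (hc.trans_le hcd)]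
  have ci : ∀ r k : ℝ, IntervalIntegrable (fun t => k * (p₁ (t * r) * Real.exp (-lam * r)))
      volume 0 1 := fun r k => by apply Continuous.intervalIntegrable; fun_prop
  have : (d - c) * -(∫ t in (0:ℝ)..1, p₁ (t * x) * Real.exp (-lam * x))
      - (d - x) * -(∫ t in (0:ℝ)..1, p₁ (t * c) * Real.exp (-lam * c))
      - (x - c) * -(∫ t in (0:ℝ)..1, p₁ (t * d) * Real.exp (-lam * d))
      = - ∫ t in (0:ℝ)..1, ((d - c) * (p₁ (t * x) * Real.exp (-lam * x))
        - (d - x) * (p₁ (t * c) * Real.exp (-lam * c))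
        - (x - c) * (p₁ (t * d) * Real.exp (-lam * d))) := by
    rw [intervalIntegral.integral_sub ((ci _ _).sub (ci _ _)) (ci _ _),
      intervalIntegral.integral_sub (ci _ _) (ci _ _)]
    simp only [intervalIntegral.integral_const_mul]
    ring
  rw [this, abs_neg]
  have := intervalIntegral.norm_integral_le_of_norm_le_const (a := (0:ℝ)) (b := 1)
    (C := K * (1 + lam) ^ 2 * (d - c) ^ 3)
    (f := fun t => (d - c) * (p₁ (t * x) * Real.exp (-lam * x))
        - (d - x) * (p₁ (t * c) * Real.exp (-lam * c))
        - (x - c) * (p₁ (t * d) * Real.exp (-lam * d))) (fun t ht => by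
      rw [uIoc_of_le zero_le_one] at ht
      have hexp : ∀ r, HasDerivAt (fun r => Real.exp (-lam * r)) (Real.exp (-lam * r) * -lam) r := by
        intro r
        have := ((hasDerivAt_id r).const_mul (-lam)).exp
        simpa using this
      have hco : ∀ {q q' : ℝ → ℝ}, (∀ x, HasDerivAt q (q' x) x) → ∀ r,
          HasDerivAt (fun r => q (t * r)) (q' (t * r) * t) r := by
        intro q q' hq r
        exact ((hq (t * r)).comp r ((hasDerivAt_id r).const_mul t)).congr_deriv (by simp)
      refine abs_interpolation_error_le
        (φ := fun r => p₁ (t * r) * Real.exp (-lam * r))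
        (φ' := fun r => p₂ (t * r) * t * Real.exp (-lam * r)
          + p₁ (t * r) * (Real.exp (-lam * r) * -lam))
        (φ'' := fun r => (p₃ (t * r) * t * t * Real.exp (-lam * r)
          + p₂ (t * r) * t * (Real.exp (-lam * r) * -lam))
          + (p₂ (t * r) * t * (Real.exp (-lam * r) * -lam)
          + p₁ (t * r) * (Real.exp (-lam * r) * -lam * -lam)))
        (fun r => (hco h2 r).mul (hexp r))
        (fun r => (((hco h3 r).mul_const t).mul (hexp r)).add
          ((hco h2 r).mul ((hexp r).mul_const (-lam)))) (fun r hr => ?_) hx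
      have hr0 : 0 ≤ r := hc.le.trans hr.1
      have hm : t * r ∈ Icc 0 L := ⟨mul_nonneg ht.1.le hr0,
        (mul_le_of_le_one_left hr0 ht.2).trans (hr.2.trans hd)⟩
      have b1 := hK1 _ hm
      have b2 := hK2 _ hm
      have b3 := hK3 _ hm
      have he0 : 0 ≤ Real.exp (-lam * r) := (Real.exp_pos _).le
      have he1 : Real.exp (-lam * r) ≤ 1 := Real.exp_le_one_iff.2 (by nlinarith)
      have hK0 : 0 ≤ K := (abs_nonneg _).trans b1
      have ht0 : 0 ≤ t := ht.1.le
      have ht1 : t ≤ 1 := ht.2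
      calc _ = |(p₃ (t * r) * (t * t) + p₂ (t * r) * (t * (-lam * 2))
              + p₁ (t * r) * lam ^ 2) * Real.exp (-lam * r)| := by congr 1; ring
        _ ≤ (|p₃ (t * r)| * (t * t) + |p₂ (t * r)| * (t * (lam * 2))
              + |p₁ (t * r)| * lam ^ 2) * Real.exp (-lam * r) := by
            rw [abs_mul, abs_of_nonneg he0]
            gcongr
            refine (abs_add_three _ _ _).trans (le_of_eq ?_)
            simp only [abs_mul, abs_neg, abs_of_nonneg ht0, abs_of_nonneg hlam, abs_pow,
              abs_two]
        _ ≤ (K * (1 * 1) + K * (1 * (lam * 2)) + K * lam ^ 2) * 1 := by gcongr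
        _ = K * (1 + lam) ^ 2 := by ring)
  simpa using this

/-- Weight of the nearer node in the cell `[l h, (l+1) h]`. -/
def nearNodeWeight (h β : ℝ) (l : ℕ) : ℝ :=
  h ^ (-(1 : ℝ) - 1) * ∫ r in (l * h)..((l + 1) * h), ((l + 1) * h - r) * r ^ (-β)

/-- Weight of the farther node in the cell `[l h, (l+1) h]`. -/
def farNodeWeight (h β : ℝ) (l : ℕ) : ℝ :=
  h ^ (-(1 : ℝ) - 1) * ∫ r in (l * h)..((l + 1) * h), (r - l * h) * r ^ (-β)

/-- Weight of the singular cell adjacent to the evaluation point. -/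
def singularWeight (h β lam : ℝ) : ℝ := h ^ (-β) * Real.exp (-lam * h) / (1 + 1 - β)

/-- Weight of a boundary node at distance `l h`. -/
def endWeight (h β lam : ℝ) (l : ℕ) : ℝ :=
  if l = 1 then singularWeight h β lam
  else farNodeWeight h β (l - 1) * Real.exp (-lam * l * h) * (l : ℝ)⁻¹

/-- Weight of an interior node at distance `l h`. -/
def nodeWeight (h β lam : ℝ) (l : ℕ) : ℝ :=
  endWeight h β lam l + nearNodeWeight h β l * Real.exp (-lam * l * h) * (l : ℝ)⁻¹

theorem nodal_sum_eq_cell_sum (h β lam : ℝ) (V : ℕ → ℝ) (m : ℕ) :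
    endWeight h β lam (m + 1) * V (m + 1)
        + ∑ l ∈ Finset.range m, nodeWeight h β lam (l + 1) * V (l + 1) =
      singularWeight h β lam * V 1 + ∑ l ∈ Finset.range m,
        (nearNodeWeight h β (l + 1) * (Real.exp (-lam * (l + 1 : ℕ) * h) * ((l + 1 : ℕ) : ℝ)⁻¹
            * V (l + 1))
          + farNodeWeight h β (l + 1) * (Real.exp (-lam * (l + 1 + 1 : ℕ) * h)
            * ((l + 1 + 1 : ℕ) : ℝ)⁻¹ * V (l + 1 + 1))) := by
  induction m with
  | zero => simp [endWeight]
  | succ m ih =>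
    rw [Finset.sum_range_succ, Finset.sum_range_succ, ← add_assoc (singularWeight h β lam * V 1),
      ← ih]
    have : endWeight h β lam (m + 1 + 1) = farNodeWeight h β (m + 1)
        * Real.exp (-lam * (m + 1 + 1 : ℕ) * h) * ((m + 1 + 1 : ℕ) : ℝ)⁻¹ := by
      simp [endWeight]
    rw [this, nodeWeight]
    ring

theorem continuousOn_rpow_const_of_subset_Ioi {s : Set ℝ} (hs : s ⊆ Ioi 0) (γ : ℝ) :
    ContinuousOn (fun r : ℝ => r ^ γ) s :=
  fun r hr => (Real.continuousAt_rpow_const r γ (Or.inl (ne_of_gt (hs hr)))).continuousWithinAt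

theorem abs_cell_error_le {p p₁ p₂ p₃ : ℝ → ℝ} {L K lam β c h : ℝ}
    (h1 : ∀ x, HasDerivAt p (p₁ x) x) (h2 : ∀ x, HasDerivAt p₁ (p₂ x) x)
    (h3 : ∀ x, HasDerivAt p₂ (p₃ x) x) (hlam : 0 ≤ lam)
    (hK1 : ∀ x ∈ Icc 0 L, |p₁ x| ≤ K) (hK2 : ∀ x ∈ Icc 0 L, |p₂ x| ≤ K)
    (hK3 : ∀ x ∈ Icc 0 L, |p₃ x| ≤ K) (hh : 0 < h) (hc : 0 < c) (hd : c + h ≤ L) :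
    |(∫ r in c..(c + h), (p 0 - p r) * Real.exp (-lam * r) * r ^ (-1 - β))
        - (h⁻¹ * (∫ r in c..(c + h), (c + h - r) * r ^ (-β))
              * ((p 0 - p c) * Real.exp (-lam * c) / c)
          + h⁻¹ * (∫ r in c..(c + h), (r - c) * r ^ (-β))
              * ((p 0 - p (c + h)) * Real.exp (-lam * (c + h)) / (c + h)))| ≤
      K * (1 + lam) ^ 2 * h ^ 2 * ∫ r in c..(c + h), r ^ (-β) := by
  have hcd : c ≤ c + h := by linarith
  have hpos : uIcc c (c + h) ⊆ Ioi 0 := by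
    rw [uIcc_of_le hcd]; exact fun r hr => hc.trans_le hr.1
  have cp : Continuous p := continuous_iff_continuousAt.2 fun x => (h1 x).continuousAt
  have cr := continuousOn_rpow_const_of_subset_Ioi hpos (-β)
  have cr' := continuousOn_rpow_const_of_subset_Ioi hpos (-1 - β)
  set v : ℝ → ℝ := fun r => (p 0 - p r) * Real.exp (-lam * r) / r with hv
  have i1 : IntervalIntegrable (fun r => (p 0 - p r) * Real.exp (-lam * r) * r ^ (-1 - β))
      volume c (c + h) := ContinuousOn.intervalIntegrable (by fun_prop)
  have i2 : IntervalIntegrable (fun r => (c + h - r) * r ^ (-β) * v c)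
      volume c (c + h) := ContinuousOn.intervalIntegrable (by fun_prop)
  have i3 : IntervalIntegrable (fun r => (r - c) * r ^ (-β) * v (c + h))
      volume c (c + h) := ContinuousOn.intervalIntegrable (by fun_prop)
  have e : (∫ r in c..(c + h), (p 0 - p r) * Real.exp (-lam * r) * r ^ (-1 - β))
        - (h⁻¹ * (∫ r in c..(c + h), (c + h - r) * r ^ (-β)) * v c
          + h⁻¹ * (∫ r in c..(c + h), (r - c) * r ^ (-β)) * v (c + h))
      = ∫ r in c..(c + h), ((p 0 - p r) * Real.exp (-lam * r) * r ^ (-1 - β)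
        - h⁻¹ * ((c + h - r) * r ^ (-β) * v c) - h⁻¹ * ((r - c) * r ^ (-β) * v (c + h))) := by
    rw [intervalIntegral.integral_sub (i1.sub (i2.const_mul _)) (i3.const_mul _),
      intervalIntegral.integral_sub i1 (i2.const_mul _)]
    simp only [intervalIntegral.integral_const_mul, intervalIntegral.integral_mul_const]
    ring
  have i4 : IntervalIntegrable (fun r => K * (1 + lam) ^ 2 * h ^ 2 * r ^ (-β)) volume c (c + h) :=
    ContinuousOn.intervalIntegrable (by fun_prop)
  rw [e, ← intervalIntegral.integral_const_mul, ← Real.norm_eq_abs]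
  refine intervalIntegral.norm_integral_le_of_norm_le hcd (Filter.Eventually.of_forall ?_) i4
  intro r hr
  have hr0 : 0 < r := hc.trans hr.1
  have hrp : 0 ≤ r ^ (-β) := Real.rpow_nonneg hr0.le _
  have key := abs_quotient_interpolation_error_le h1 h2 h3 hlam hK1 hK2 hK3 hc hd
    (x := r) ⟨hr.1.le, hr.2⟩
  rw [add_sub_cancel_left] at key
  have es : (p 0 - p r) * Real.exp (-lam * r) * r ^ (-1 - β)
        - h⁻¹ * ((c + h - r) * r ^ (-β) * v c) - h⁻¹ * ((r - c) * r ^ (-β) * v (c + h))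
      = h⁻¹ * (h * v r - (c + h - r) * v c - (r - c) * v (c + h)) * r ^ (-β) := by
    have : r ^ (-1 - β) = r ^ (-β) / r := by
      rw [← Real.rpow_sub_one hr0.ne']; congr 1; ring
    rw [this]
    simp only [hv]
    field_simp
  rw [Real.norm_eq_abs, es, abs_mul, abs_mul, abs_of_nonneg hrp, abs_of_pos (inv_pos.2 hh)]
  calc _ ≤ h⁻¹ * (K * (1 + lam) ^ 2 * h ^ 3) * r ^ (-β) := by gcongr
    _ = _ := by field_simp

theorem abs_far_field_error_le {p p₁ p₂ p₃ : ℝ → ℝ} {L K lam β h : ℝ} (hβ : β < 1)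
    (h1 : ∀ x, HasDerivAt p (p₁ x) x) (h2 : ∀ x, HasDerivAt p₁ (p₂ x) x)
    (h3 : ∀ x, HasDerivAt p₂ (p₃ x) x) (hlam : 0 ≤ lam)
    (hK1 : ∀ x ∈ Icc 0 L, |p₁ x| ≤ K) (hK2 : ∀ x ∈ Icc 0 L, |p₂ x| ≤ K)
    (hK3 : ∀ x ∈ Icc 0 L, |p₃ x| ≤ K) (hh : 0 < h) (m : ℕ) (hm : (m + 1) * h ≤ L) :
    |(∫ r in h..((m + 1) * h), (p 0 - p r) * Real.exp (-lam * r) * r ^ (-1 - β))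
        - ∑ l ∈ Finset.range m,
        (nearNodeWeight h β (l + 1) * (Real.exp (-lam * (l + 1 : ℕ) * h) * ((l + 1 : ℕ) : ℝ)⁻¹
            * (p 0 - p ((l + 1 : ℕ) * h)))
          + farNodeWeight h β (l + 1) * (Real.exp (-lam * (l + 1 + 1 : ℕ) * h)
            * ((l + 1 + 1 : ℕ) : ℝ)⁻¹ * (p 0 - p ((l + 1 + 1 : ℕ) * h))))| ≤
      K * (1 + lam) ^ 2 * h ^ 2 * (L ^ (1 - β) / (1 - β)) := by
  have cp : Continuous p := continuous_iff_continuousAt.2 fun x => (h1 x).continuousAt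
  have hpos : ∀ l : ℕ, uIcc (((l : ℕ) + 1) * h) (((l + 1 : ℕ) + 1) * h) ⊆ Ioi 0 := by
    intro l r hr
    rw [uIcc_of_le (by push_cast; gcongr; linarith)] at hr
    exact lt_of_lt_of_le (by positivity) hr.1
  have s1 := intervalIntegral.sum_integral_adjacent_intervals (n := m) (μ := volume)
    (a := fun l : ℕ => ((l : ℝ) + 1) * h)
    (f := fun r => (p 0 - p r) * Real.exp (-lam * r) * r ^ (-1 - β)) (fun l _ => by
      have := continuousOn_rpow_const_of_subset_Ioi (hpos l) (-1 - β)
      exact ContinuousOn.intervalIntegrable (by fun_prop))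
  have s2 := intervalIntegral.sum_integral_adjacent_intervals (n := m) (μ := volume)
    (a := fun l : ℕ => ((l : ℝ) + 1) * h) (f := fun r => r ^ (-β)) (fun l _ => by
      have := continuousOn_rpow_const_of_subset_Ioi (hpos l) (-β)
      exact ContinuousOn.intervalIntegrable (by fun_prop))
  simp only [Nat.cast_zero, zero_add, one_mul] at s1 s2
  rw [← s1, ← Finset.sum_sub_distrib]
  have hK0 : 0 ≤ K := (abs_nonneg _).trans (hK1 0 ⟨le_rfl, by
    refine le_trans ?_ hm; positivity⟩)
  have hbound : ∫ r in h..((m + 1) * h), r ^ (-β) ≤ L ^ (1 - β) / (1 - β) := by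
    rw [integral_rpow (Or.inl (by linarith))]
    have e : -β + 1 = 1 - β := by ring
    rw [e]
    have : ((m + 1) * h) ^ (1 - β) ≤ L ^ (1 - β) :=
      Real.rpow_le_rpow (by positivity) hm (by linarith)
    have := Real.rpow_nonneg hh.le (1 - β)
    have : 0 < 1 - β := by linarith
    gcongr
    linarith
  calc _ ≤ _ := Finset.abs_sum_le_sum_abs _ _
    _ ≤ ∑ l ∈ Finset.range m, K * (1 + lam) ^ 2 * h ^ 2
          * ∫ r in (((l : ℕ) + 1) * h)..(((l + 1 : ℕ) + 1) * h), r ^ (-β) := by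
        refine Finset.sum_le_sum fun l hl => ?_
        have hl' : ((l : ℝ) + 1) + 1 ≤ m + 1 := by
          have : l + 1 ≤ m := Finset.mem_range.1 hl
          have : ((l + 1 : ℕ) : ℝ) ≤ m := by exact_mod_cast this
          push_cast at this; linarith
        have hl1 : (0:ℝ) < (l : ℝ) + 1 := by positivity
        have := abs_cell_error_le (β := β) (c := ((l : ℝ) + 1) * h) h1 h2 h3 hlam hK1 hK2 hK3 hh
          (by positivity) (by
            refine le_trans ?_ hm
            calc ((l : ℝ) + 1) * h + h = (((l : ℝ) + 1) + 1) * h := by ring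
              _ ≤ _ := by gcongr)
        have ee : ((l : ℝ) + 1) * h + h = (((l + 1 : ℕ) : ℝ) + 1) * h := by push_cast; ring
        rw [ee] at this
        refine le_trans (le_of_eq ?_) this
        have h2i : h ^ (-(1:ℝ) - 1) = h⁻¹ * h⁻¹ := by
          rw [Real.rpow_sub_one hh.ne', Real.rpow_neg_one]; rfl
        congr 1
        simp only [nearNodeWeight, farNodeWeight, h2i]
        push_cast
        congr 1
        field_simp
    _ = _ := by rw [← Finset.mul_sum, s2]
    _ ≤ _ := by gcongr

theorem abs_singular_cell_error_le {U U₁ U₂ U₃ : ℝ → ℝ} {a b K lam β h x ε : ℝ} (hβ : β < 1)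
    (h1 : ∀ x, HasDerivAt U (U₁ x) x) (h2 : ∀ x, HasDerivAt U₁ (U₂ x) x)
    (h3 : ∀ x, HasDerivAt U₂ (U₃ x) x) (hlam : 0 ≤ lam)
    (hK2 : ∀ x ∈ Icc a b, |U₂ x| ≤ K)
    (hK3 : ∀ x ∈ Icc a b, |U₃ x| ≤ K) (hh : 0 < h) (hxa : a ≤ x - h) (hxb : x + h ≤ b)
    (hε : 0 < ε) (hεh : ε ≤ h) :
    |(∫ t in ε..h, (2 * U x - U (x - t) - U (x + t)) * Real.exp (-lam * t) * t ^ (-1 - β))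
        - singularWeight h β lam * (2 * U x - U (x - h) - U (x + h))| ≤
      4 * K * (1 + lam) * h ^ 2 * h ^ (1 - β)
        + |(2 * U x - U (x - h) - U (x + h)) * Real.exp (-lam * h) / h ^ 2| * ε ^ (2 - β) := by
  have hx : x ∈ Icc a b := ⟨by linarith, by linarith⟩
  have hK0 : 0 ≤ K := (abs_nonneg _).trans (hK2 x hx)
  have cU : Continuous U := continuous_iff_continuousAt.2 fun x => (h1 x).continuousAt
  set D : ℝ → ℝ := fun t => 2 * U x - U (x - t) - U (x + t) with hD
  set Q : ℝ → ℝ := fun t => D t * Real.exp (-lam * t) / t ^ 2 with hQ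
  have hpos : uIcc ε h ⊆ Ioi 0 := by
    rw [uIcc_of_le hεh]; exact fun r hr => hε.trans_le hr.1
  have cr := continuousOn_rpow_const_of_subset_Ioi hpos (1 - β)
  have cr' := continuousOn_rpow_const_of_subset_Ioi hpos (-1 - β)
  have hexp : ∀ t, 0 ≤ t → t ≤ h → |Real.exp (-lam * t) - Real.exp (-lam * h)| ≤ lam * h := by
    intro t ht hth
    have l1 : Real.exp (-lam * t) ≤ 1 := Real.exp_le_one_iff.2 (by nlinarith)
    have l2 : Real.exp (-lam * h) ≤ Real.exp (-lam * t) := Real.exp_le_exp.2 (by nlinarith)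
    have l3 := Real.add_one_le_exp (-lam * h)
    rw [abs_of_nonneg (by linarith)]
    linarith
  have hE : ∀ t, 0 < t → t ≤ h → |D t / t ^ 2 + U₂ x| ≤ 2 * K * h := by
    intro t ht hth
    have t1 := abs_taylor_second_le h1 h2 h3 hK3 hx (y := x + t) ⟨by linarith, by linarith⟩
    have t2 := abs_taylor_second_le h1 h2 h3 hK3 hx (y := x - t) ⟨by linarith, by linarith⟩
    have s1 : x + t - x = t := by ring
    have s2 : x - t - x = -t := by ring
    rw [s1, abs_of_pos ht] at t1
    rw [s2, abs_neg, abs_of_pos ht] at t2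
    have e : D t / t ^ 2 + U₂ x = -((U (x + t) - U x - U₁ x * t - U₂ x * t ^ 2 / 2)
        + (U (x - t) - U x - U₁ x * -t - U₂ x * (-t) ^ 2 / 2)) / t ^ 2 := by
      simp only [hD]; field_simp; ring
    rw [e, abs_div, abs_neg, abs_of_pos (pow_pos ht 2), div_le_iff₀ (pow_pos ht 2)]
    calc _ ≤ K * t ^ 3 + K * t ^ 3 := (abs_add_le _ _).trans (add_le_add t1 t2)
      _ = 2 * K * t * t ^ 2 := by ring
      _ ≤ 2 * K * h * t ^ 2 := by gcongr
  have hQh : ∀ t, 0 < t → t ≤ h → |Q t - Q h| ≤ 4 * K * (1 + lam) * h := by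
    intro t ht hth
    have l1 : Real.exp (-lam * t) ≤ 1 := Real.exp_le_one_iff.2 (by nlinarith)
    have l2 : Real.exp (-lam * h) ≤ 1 := Real.exp_le_one_iff.2 (by nlinarith)
    have e : Q t - Q h = (D t / t ^ 2 + U₂ x) * Real.exp (-lam * t)
        + -((D h / h ^ 2 + U₂ x) * Real.exp (-lam * h))
        + -(U₂ x * (Real.exp (-lam * t) - Real.exp (-lam * h))) := by
      simp only [hQ]; ring
    rw [e]
    refine (abs_add_three _ _ _).trans ?_
    simp only [abs_neg, abs_mul, Real.abs_exp]
    calc _ ≤ (2 * K * h) * 1 + (2 * K * h) * 1 + K * (lam * h) := by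
          gcongr
          · exact hE t ht hth
          · exact hE h hh le_rfl
          · exact hK2 x hx
          · exact hexp t ht.le hth
      _ ≤ _ := by
          have : 0 ≤ K * lam * h := by positivity
          nlinarith
  have ihε : IntervalIntegrable (fun t : ℝ => Q h * t ^ (1 - β)) volume ε h :=
    ContinuousOn.intervalIntegrable (by fun_prop)
  have hint : ∀ t : ℝ, 0 ≤ t → ∫ r in (0:ℝ)..t, r ^ (1 - β) = t ^ (2 - β) / (2 - β) := by
    intro t _
    rw [integral_rpow (Or.inl (by linarith))]
    have e : 1 - β + 1 = 2 - β := by ring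
    rw [e, Real.zero_rpow (by linarith), sub_zero]
  have hi0 : ∀ s t : ℝ, IntervalIntegrable (fun r : ℝ => r ^ (1 - β)) volume s t := fun s t =>
    intervalIntegral.intervalIntegrable_rpow' (by linarith)
  have hεint : ∫ r in ε..h, r ^ (1 - β) = h ^ (2 - β) / (2 - β) - ε ^ (2 - β) / (2 - β) := by
    rw [← hint h hh.le, ← hint ε hε.le, intervalIntegral.integral_interval_sub_left (hi0 _ _) (hi0 _ _)]
  have hw : singularWeight h β lam * D h = Q h * (h ^ (2 - β) / (2 - β)) := by
    have e : h ^ (2 - β) = h ^ (-β) * h ^ 2 := by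
      rw [← Real.rpow_natCast, ← Real.rpow_add hh]; congr 1; push_cast; ring
    have : (1 + 1 - β) = 2 - β := by ring
    simp only [singularWeight, hQ, this]
    rw [e]; field_simp
  have hsplit : (∫ t in ε..h, D t * Real.exp (-lam * t) * t ^ (-1 - β))
        - singularWeight h β lam * D h
      = (∫ t in ε..h, (Q t - Q h) * t ^ (1 - β)) - Q h * (ε ^ (2 - β) / (2 - β)) := by
    have e1 : ∫ t in ε..h, (Q t - Q h) * t ^ (1 - β)
        = ∫ t in ε..h, (D t * Real.exp (-lam * t) * t ^ (-1 - β) - Q h * t ^ (1 - β)) := by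
      refine intervalIntegral.integral_congr fun t ht => ?_
      have ht0 : 0 < t := hpos ht
      have : t ^ (1 - β) = t ^ (-1 - β) * t ^ 2 := by
        rw [← Real.rpow_natCast, ← Real.rpow_add ht0]; congr 1; push_cast; ring
      simp only [sub_mul]
      congr 1
      simp only [hQ]
      rw [this]; field_simp
    rw [e1, intervalIntegral.integral_sub (ContinuousOn.intervalIntegrable (by fun_prop)) ihε,
      intervalIntegral.integral_const_mul, hεint, hw]
    ring
  rw [hsplit]
  have h2β : 1 ≤ 2 - β := by linarith
  refine (abs_sub _ _).trans (add_le_add ?_ ?_)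
  · calc _ ≤ ∫ t in ε..h, 4 * K * (1 + lam) * h * t ^ (1 - β) := by
          rw [← Real.norm_eq_abs]
          refine intervalIntegral.norm_integral_le_of_norm_le hεh
            (Filter.Eventually.of_forall fun t ht => ?_) ((hi0 _ _).const_mul _)
          have ht0 : 0 < t := hε.trans ht.1
          have : 0 ≤ t ^ (1 - β) := Real.rpow_nonneg ht0.le _
          rw [Real.norm_eq_abs, abs_mul, abs_of_nonneg this]
          gcongr
          exact hQh t ht0 ht.2
      _ = 4 * K * (1 + lam) * h * (h ^ (2 - β) / (2 - β) - ε ^ (2 - β) / (2 - β)) := by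
          rw [intervalIntegral.integral_const_mul, hεint]
      _ ≤ 4 * K * (1 + lam) * h * h ^ (2 - β) := by
          gcongr
          have q1 : 0 ≤ ε ^ (2 - β) / (2 - β) :=
            div_nonneg (Real.rpow_nonneg hε.le _) (by linarith)
          have q2 := div_le_self (Real.rpow_nonneg hh.le (2 - β)) h2β
          linarith
      _ = _ := by
          have : h ^ (2 - β) = h * h ^ (1 - β) := by
            rw [mul_comm, ← Real.rpow_add_one hh.ne']; congr 1; ring
          rw [this]; ring
  · have q0 : 0 ≤ ε ^ (2 - β) := Real.rpow_nonneg hε.le _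
    rw [abs_mul, abs_of_nonneg (div_nonneg q0 (by linarith))]
    gcongr
    exact div_le_self q0 h2β

theorem integrableOn_tempered_kernel {β lam δ : ℝ} (hβ : 0 < β) (hlam : 0 ≤ lam) (hδ : 0 < δ) :
    IntegrableOn (fun r : ℝ => Real.exp (-lam * r) * r ^ (-1 - β)) (Ioi δ) := by
  refine Integrable.mono' (integrableOn_Ioi_rpow_of_lt (by linarith : -1 - β < -1) hδ) ?_ ?_
  · exact (by fun_prop : Measurable fun r : ℝ => Real.exp (-lam * r) * r ^ (-1 - β)).aestronglyMeasurable
  · refine (ae_restrict_iff' measurableSet_Ioi).2 (Filter.Eventually.of_forall fun r hr => ?_)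
    have hr0 : 0 < r := hδ.trans hr
    have h1 : 0 ≤ r ^ (-1 - β) := Real.rpow_nonneg hr0.le _
    have h2 : Real.exp (-lam * r) ≤ 1 := Real.exp_le_one_iff.2 (by nlinarith)
    rw [Real.norm_eq_abs, abs_of_nonneg (by positivity)]
    exact mul_le_of_le_one_left h1 h2

theorem integrableOn_tempered_kernel_Iio {β lam a x : ℝ} (hβ : 0 < β) (hlam : 0 ≤ lam)
    (hx : a < x) :
    IntegrableOn (fun y : ℝ => Real.exp (-lam * |x - y|) * |x - y| ^ (-1 - β)) (Iio a) := by
  have h := ((Measure.measurePreserving_sub_left volume x).integrableOn_comp_preimage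
    (MeasurableEquiv.subLeft x).measurableEmbedding).2
    (integrableOn_tempered_kernel hβ hlam (sub_pos.2 hx))
  have e : (fun y => x - y) ⁻¹' Ioi (x - a) = Iio a := by ext y; simp
  rw [e] at h
  refine h.congr_fun (fun y hy => ?_) measurableSet_Iio
  have : 0 < x - y := by linarith [mem_Iio.1 hy]
  simp only [Function.comp, abs_of_pos this]

theorem integrableOn_tempered_kernel_Ioi {β lam b x : ℝ} (hβ : 0 < β) (hlam : 0 ≤ lam)
    (hx : x < b) :
    IntegrableOn (fun y : ℝ => Real.exp (-lam * |x - y|) * |x - y| ^ (-1 - β)) (Ioi b) := by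
  have h := ((measurePreserving_sub_right volume x).integrableOn_comp_preimage
    (MeasurableEquiv.subRight x).measurableEmbedding).2
    (integrableOn_tempered_kernel hβ hlam (sub_pos.2 hx))
  have e : (fun y => y - x) ⁻¹' Ioi (b - x) = Ioi b := by ext y; simp
  rw [e] at h
  refine h.congr_fun (fun y hy => ?_) measurableSet_Ioi
  have : 0 < y - x := by linarith [mem_Ioi.1 hy]
  simp only [Function.comp, abs_sub_comm x y, abs_of_pos this]

theorem exterior_integral_eq {β lam x : ℝ} {u g : ℝ → ℝ} {S T : Set ℝ} (hg : Measurable g)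
    (hS : MeasurableSet S) (hST : S ⊆ T) (hug : ∀ y ∈ S, u y = g y)
    (hk : IntegrableOn (fun y : ℝ => Real.exp (-lam * |x - y|) * |x - y| ^ (-1 - β)) S)
    (hgint : IntegrableOn (fun y => |g y| * Real.exp (-lam * |x - y|) * |x - y| ^ (-1 - β)) T) :
    IntegrableOn (fun y => (u x - u y) * Real.exp (-lam * |x - y|) * |x - y| ^ (-1 - β)) S ∧
    ∫ y in S, (u x - u y) * Real.exp (-lam * |x - y|) * |x - y| ^ (-1 - β) =
      u x * (∫ y in S, Real.exp (-lam * |x - y|) * |x - y| ^ (-1 - β))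
        - ∫ y in S, g y * Real.exp (-lam * |x - y|) * |x - y| ^ (-1 - β) := by
  have hg' : IntegrableOn (fun y => g y * Real.exp (-lam * |x - y|) * |x - y| ^ (-1 - β)) S := by
    refine Integrable.mono (hgint.mono_set hST) (by fun_prop : Measurable fun y =>
      g y * Real.exp (-lam * |x - y|) * |x - y| ^ (-1 - β)).aestronglyMeasurable
      (Filter.Eventually.of_forall fun y => ?_)
    simp
  have hc : EqOn (fun y => (u x - u y) * Real.exp (-lam * |x - y|) * |x - y| ^ (-1 - β))
      (fun y => u x * (Real.exp (-lam * |x - y|) * |x - y| ^ (-1 - β))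
        - g y * Real.exp (-lam * |x - y|) * |x - y| ^ (-1 - β)) S := fun y hy => by
    simp only [hug y hy]; ring
  refine ⟨IntegrableOn.congr_fun ((hk.const_mul (u x)).sub hg') hc.symm hS, ?_⟩
  rw [setIntegral_congr_fun hS hc, integral_sub (hk.const_mul (u x)) hg', integral_const_mul]

theorem truncated_integral_eq {a b β lam x ε : ℝ} {u g U : ℝ → ℝ} (hβ : 0 < β) (hlam : 0 ≤ lam)
    (hg : Measurable g) (hug : ∀ y, y ∉ Ioo a b → u y = g y)
    (hgint : IntegrableOn (fun y => |g y| * Real.exp (-lam * |x - y|) * |x - y| ^ (-1 - β))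
      (Ioo a b)ᶜ)
    (hU : Continuous U) (hUu : EqOn U u (Icc a b)) (hε : 0 < ε) (hxa : ε ≤ x - a)
    (hxb : ε ≤ b - x) :
    ∫ y in {y : ℝ | ε < |x - y|}, (u x - u y) * Real.exp (-lam * |x - y|) * |x - y| ^ (-1 - β) =
      (u x * (∫ y in Iio a, Real.exp (lam * (y - x)) * (x - y) ^ (-1 - β))
        - ∫ y in Iio a, g y * Real.exp (-lam * (x - y)) * (x - y) ^ (-1 - β))
      + (u x * (∫ y in Ioi b, Real.exp (lam * (x - y)) * (y - x) ^ (-1 - β))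
        - ∫ y in Ioi b, g y * Real.exp (-lam * (y - x)) * (y - x) ^ (-1 - β))
      + (∫ r in ε..(x - a), (U x - U (x - r)) * Real.exp (-lam * r) * r ^ (-1 - β))
      + ∫ r in ε..(b - x), (U x - U (x + r)) * Real.exp (-lam * r) * r ^ (-1 - β) := by
  have hax : a < x := by linarith
  have hxb' : x < b := by linarith
  have hxm : x ∈ Icc a b := ⟨hax.le, hxb'.le⟩
  set F : ℝ → ℝ := fun y => (u x - u y) * Real.exp (-lam * |x - y|) * |x - y| ^ (-1 - β) with hF
  obtain ⟨iL, eL⟩ := exterior_integral_eq (u := u) (x := x) (S := Iio a)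
    (T := (Ioo a b)ᶜ) hg measurableSet_Iio
    (fun y hy hy' => absurd hy'.1 (not_lt.2 (mem_Iio.1 hy).le))
    (fun y hy => hug y fun hy' => absurd hy'.1 (not_lt.2 (mem_Iio.1 hy).le))
    (integrableOn_tempered_kernel_Iio hβ hlam hax) hgint
  obtain ⟨iR, eR⟩ := exterior_integral_eq (u := u) (x := x) (S := Ioi b)
    (T := (Ioo a b)ᶜ) hg measurableSet_Ioi
    (fun y hy hy' => absurd hy'.2 (not_lt.2 (mem_Ioi.1 hy).le))
    (fun y hy => hug y fun hy' => absurd hy'.2 (not_lt.2 (mem_Ioi.1 hy).le))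
    (integrableOn_tempered_kernel_Ioi hβ hlam hxb') hgint
  have cL : EqOn F (fun y => (U x - U (x - (x - y))) * Real.exp (-lam * (x - y))
      * (x - y) ^ (-1 - β)) (Icc a (x - ε)) := fun y hy => by
    have h1 : 0 < x - y := by linarith [hy.2]
    have h2 : U y = u y := hUu ⟨hy.1, by linarith [hy.2]⟩
    simp only [hF, sub_sub_cancel, h2, hUu hxm, abs_of_pos h1]
  have cR : EqOn F (fun y => (U x - U (x + (y - x))) * Real.exp (-lam * (y - x))
      * (y - x) ^ (-1 - β)) (Icc (x + ε) b) := fun y hy => by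
    have h1 : 0 < y - x := by linarith [hy.1]
    have h2 : U y = u y := hUu ⟨by linarith [hy.1], hy.2⟩
    simp only [hF, add_sub_cancel, h2, hUu hxm, abs_sub_comm x y, abs_of_pos h1]
  have hcontL : ContinuousOn F (Icc a (x - ε)) := by
    refine ContinuousOn.congr ?_ cL
    refine ContinuousOn.mul (by fun_prop) (fun y hy => ?_)
    have h1 : x - y ≠ 0 := by linarith [hy.2]
    exact ((continuous_const.sub continuous_id).continuousAt.rpow_const (Or.inl h1)).continuousWithinAt
  have hcontR : ContinuousOn F (Icc (x + ε) b) := by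
    refine ContinuousOn.congr ?_ cR
    refine ContinuousOn.mul (by fun_prop) (fun y hy => ?_)
    have h1 : y - x ≠ 0 := by linarith [hy.1]
    exact ((continuous_id.sub continuous_const).continuousAt.rpow_const (Or.inl h1)).continuousWithinAt
  have hset : {y : ℝ | ε < |x - y|} = (Iio a ∪ Ico a (x - ε)) ∪ (Ioc (x + ε) b ∪ Ioi b) := by
    rw [Iio_union_Ico_eq_Iio (by linarith), Ioc_union_Ioi_eq_Ioi (by linarith)]
    ext y
    simp only [mem_ofPred_eq, mem_union, mem_Iio, mem_Ioi, lt_abs]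
    constructor <;> rintro (h | h)
    · left; linarith
    · right; linarith
    · left; linarith
    · right; linarith
  have iL' : IntegrableOn F (Ico a (x - ε)) := hcontL.integrableOn_Icc.mono_set Ico_subset_Icc_self
  have iR' : IntegrableOn F (Ioc (x + ε) b) := hcontR.integrableOn_Icc.mono_set Ioc_subset_Icc_self
  rw [hset, setIntegral_union ?_ (measurableSet_Ioc.union measurableSet_Ioi) (iL.union iL')
      (iR'.union iR),
    setIntegral_union ?_ measurableSet_Ico iL iL', setIntegral_union ?_ measurableSet_Ioi iR' iR,
    eL, eR]
  · have k1 : ∫ y in Iio a, Real.exp (-lam * |x - y|) * |x - y| ^ (-1 - β)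
        = ∫ y in Iio a, Real.exp (lam * (y - x)) * (x - y) ^ (-1 - β) :=
      setIntegral_congr_fun measurableSet_Iio fun y hy => by
        have : 0 < x - y := by linarith [mem_Iio.1 hy]
        simp only [abs_of_pos this]; congr 2; ring
    have k2 : ∫ y in Ioi b, Real.exp (-lam * |x - y|) * |x - y| ^ (-1 - β)
        = ∫ y in Ioi b, Real.exp (lam * (x - y)) * (y - x) ^ (-1 - β) :=
      setIntegral_congr_fun measurableSet_Ioi fun y hy => by
        have : 0 < y - x := by linarith [mem_Ioi.1 hy]
        simp only [abs_sub_comm x y, abs_of_pos this]; congr 2; ring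
    have k3 : ∫ y in Iio a, g y * Real.exp (-lam * |x - y|) * |x - y| ^ (-1 - β)
        = ∫ y in Iio a, g y * Real.exp (-lam * (x - y)) * (x - y) ^ (-1 - β) :=
      setIntegral_congr_fun measurableSet_Iio fun y hy => by
        have : 0 < x - y := by linarith [mem_Iio.1 hy]
        simp only [abs_of_pos this]
    have k4 : ∫ y in Ioi b, g y * Real.exp (-lam * |x - y|) * |x - y| ^ (-1 - β)
        = ∫ y in Ioi b, g y * Real.exp (-lam * (y - x)) * (y - x) ^ (-1 - β) :=
      setIntegral_congr_fun measurableSet_Ioi fun y hy => by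
        have : 0 < y - x := by linarith [mem_Ioi.1 hy]
        simp only [abs_sub_comm x y, abs_of_pos this]
    have k5 : ∫ y in Ico a (x - ε), F y
        = ∫ r in ε..(x - a), (U x - U (x - r)) * Real.exp (-lam * r) * r ^ (-1 - β) := by
      rw [setIntegral_congr_fun measurableSet_Ico (cL.mono Ico_subset_Icc_self),
        integral_Ico_eq_integral_Ioo, ← integral_Ioc_eq_integral_Ioo,
        ← intervalIntegral.integral_of_le (by linarith),
        intervalIntegral.integral_comp_sub_left
          (fun r => (U x - U (x - r)) * Real.exp (-lam * r) * r ^ (-1 - β)) x, sub_sub_cancel]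
    have k6 : ∫ y in Ioc (x + ε) b, F y
        = ∫ r in ε..(b - x), (U x - U (x + r)) * Real.exp (-lam * r) * r ^ (-1 - β) := by
      rw [setIntegral_congr_fun measurableSet_Ioc (cR.mono Ioc_subset_Icc_self),
        ← intervalIntegral.integral_of_le (by linarith),
        intervalIntegral.integral_comp_sub_right
          (fun r => (U x - U (x + r)) * Real.exp (-lam * r) * r ^ (-1 - β)) x, add_sub_cancel_left]
    rw [k1, k2, k3, k4, k5, k6]
    ring
  · exact disjoint_left.2 fun y h1 h2 => absurd h1.2 (not_le.2 (mem_Ioi.1 h2)) 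
  · exact disjoint_left.2 fun y h1 h2 => absurd h2.1 (not_le.2 (mem_Iio.1 h1))
  · rw [Iio_union_Ico_eq_Iio (by linarith), Ioc_union_Ioi_eq_Ioi (by linarith)]
    exact disjoint_left.2 fun y h1 h2 => by
      have := mem_Iio.1 h1; have := mem_Ioi.1 h2; linarith

theorem abs_truncation_error_le {a b β lam x h K fx : ℝ} {u g U U₁ U₂ U₃ : ℝ → ℝ} (hβ : 0 < β)
    (hβ1 : β < 1) (hlam : 0 ≤ lam)
    (hg : Measurable g) (hug : ∀ y, y ∉ Ioo a b → u y = g y)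
    (hgint : IntegrableOn (fun y => |g y| * Real.exp (-lam * |x - y|) * |x - y| ^ (-1 - β))
      (Ioo a b)ᶜ)
    (h1 : ∀ x, HasDerivAt U (U₁ x) x) (h2 : ∀ x, HasDerivAt U₁ (U₂ x) x)
    (h3 : ∀ x, HasDerivAt U₂ (U₃ x) x) (hUu : EqOn U u (Icc a b))
    (hK1 : ∀ x ∈ Icc a b, |U₁ x| ≤ K) (hK2 : ∀ x ∈ Icc a b, |U₂ x| ≤ K)
    (hK3 : ∀ x ∈ Icc a b, |U₃ x| ≤ K) (hh : 0 < h) (n m : ℕ)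
    (hxa : x - a = (n + 1) * h) (hxb : b - x = (m + 1) * h)
    (hf : Filter.Tendsto (fun ε : ℝ => ∫ y in {y : ℝ | ε < |x - y|},
          (u x - u y) * Real.exp (-lam * |x - y|) * |x - y| ^ (-1 - β))
        (nhdsWithin 0 (Set.Ioi 0)) (nhds fx)) :
    |fx - ((u x * (∫ y in Iio a, Real.exp (lam * (y - x)) * (x - y) ^ (-1 - β))
        - ∫ y in Iio a, g y * Real.exp (-lam * (x - y)) * (x - y) ^ (-1 - β))
      + (u x * (∫ y in Ioi b, Real.exp (lam * (x - y)) * (y - x) ^ (-1 - β))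
        - ∫ y in Ioi b, g y * Real.exp (-lam * (y - x)) * (y - x) ^ (-1 - β))
      + (endWeight h β lam (n + 1) * (U x - U (x - (n + 1 : ℕ) * h))
        + ∑ l ∈ Finset.range n, nodeWeight h β lam (l + 1) * (U x - U (x - (l + 1 : ℕ) * h)))
      + (endWeight h β lam (m + 1) * (U x - U (x + (m + 1 : ℕ) * h))
        + ∑ l ∈ Finset.range m, nodeWeight h β lam (l + 1) * (U x - U (x + (l + 1 : ℕ) * h))))| ≤
      (4 * K * (1 + lam) * (b - a) ^ (1 - β)
        + 2 * (K * (1 + lam) ^ 2 * ((b - a) ^ (1 - β) / (1 - β)))) * h ^ 2 := by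
  have hn : h ≤ x - a := by
    rw [hxa]; exact le_mul_of_one_le_left hh.le (by linarith [(Nat.cast_nonneg n : (0:ℝ) ≤ n)])
  have hm : h ≤ b - x := by
    rw [hxb]; exact le_mul_of_one_le_left hh.le (by linarith [(Nat.cast_nonneg m : (0:ℝ) ≤ m)])
  have cU : Continuous U := continuous_iff_continuousAt.2 fun x => (h1 x).continuousAt
  have hK0 : 0 ≤ K := (abs_nonneg _).trans (hK1 x ⟨by linarith, by linarith⟩)
  have h1β : 0 < 1 - β := by linarith
  have rpow_mono : ∀ {t}, 0 ≤ t → t ≤ b - a → t ^ (1 - β) ≤ (b - a) ^ (1 - β) := fun h0 h1 =>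
    Real.rpow_le_rpow h0 h1 h1β.le
  have hinL : ∀ r ∈ Icc 0 (x - a), x - r ∈ Icc a b := fun r hr =>
    ⟨by linarith [hr.2], by linarith [hr.1]⟩
  have hinR : ∀ r ∈ Icc 0 (b - x), x + r ∈ Icc a b := fun r hr =>
    ⟨by linarith [hr.1], by linarith [hr.2]⟩
  have farL := abs_far_field_error_le (p := fun r => U (x - r)) (p₁ := fun r => -U₁ (x - r))
    (p₂ := fun r => - -U₂ (x - r)) (p₃ := fun r => - - -U₃ (x - r)) (L := x - a) hβ1
    (fun r => HasDerivAt.comp_const_sub x r (h1 _))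
    (fun r => (HasDerivAt.comp_const_sub x r (h2 _)).neg)
    (fun r => (HasDerivAt.comp_const_sub x r (h3 _)).neg.neg) hlam
    (fun r hr => by simpa using hK1 _ (hinL r hr)) (fun r hr => by simpa using hK2 _ (hinL r hr))
    (fun r hr => by simpa using hK3 _ (hinL r hr)) hh n hxa.ge
  have farR := abs_far_field_error_le (p := fun r => U (x + r)) (p₁ := fun r => U₁ (x + r))
    (p₂ := fun r => U₂ (x + r)) (p₃ := fun r => U₃ (x + r)) (L := b - x) hβ1
    (fun r => HasDerivAt.comp_const_add x r (h1 _))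
    (fun r => HasDerivAt.comp_const_add x r (h2 _))
    (fun r => HasDerivAt.comp_const_add x r (h3 _)) hlam
    (fun r hr => hK1 _ (hinR r hr)) (fun r hr => hK2 _ (hinR r hr))
    (fun r hr => hK3 _ (hinR r hr)) hh m hxb.ge
  have telL := nodal_sum_eq_cell_sum h β lam (fun l => U x - U (x - (l : ℕ) * h)) n
  have telR := nodal_sum_eq_cell_sum h β lam (fun l => U x - U (x + (l : ℕ) * h)) m
  simp only [sub_zero, add_zero] at farL farR
  rw [telL, telR]
  rw [← hxa] at farL
  rw [← hxb] at farR
  set SL := ∑ l ∈ Finset.range n,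
    (nearNodeWeight h β (l + 1) * (Real.exp (-lam * (l + 1 : ℕ) * h) * ((l + 1 : ℕ) : ℝ)⁻¹
        * (U x - U (x - (l + 1 : ℕ) * h)))
      + farNodeWeight h β (l + 1) * (Real.exp (-lam * (l + 1 + 1 : ℕ) * h)
        * ((l + 1 + 1 : ℕ) : ℝ)⁻¹ * (U x - U (x - (l + 1 + 1 : ℕ) * h))))
  set SR := ∑ l ∈ Finset.range m,
    (nearNodeWeight h β (l + 1) * (Real.exp (-lam * (l + 1 : ℕ) * h) * ((l + 1 : ℕ) : ℝ)⁻¹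
        * (U x - U (x + (l + 1 : ℕ) * h)))
      + farNodeWeight h β (l + 1) * (Real.exp (-lam * (l + 1 + 1 : ℕ) * h)
        * ((l + 1 + 1 : ℕ) : ℝ)⁻¹ * (U x - U (x + (l + 1 + 1 : ℕ) * h))))
  have e1 : (((1 : ℕ) : ℝ)) * h = h := by simp
  rw [e1]
  set G := (u x * (∫ y in Iio a, Real.exp (lam * (y - x)) * (x - y) ^ (-1 - β))
        - ∫ y in Iio a, g y * Real.exp (-lam * (x - y)) * (x - y) ^ (-1 - β))
      + (u x * (∫ y in Ioi b, Real.exp (lam * (x - y)) * (y - x) ^ (-1 - β))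
        - ∫ y in Ioi b, g y * Real.exp (-lam * (y - x)) * (y - x) ^ (-1 - β))
  set c := |(2 * U x - U (x - h) - U (x + h)) * Real.exp (-lam * h) / h ^ 2|
  set W := singularWeight h β lam
  set FL := ∫ r in h..(x - a), (U x - U (x - r)) * Real.exp (-lam * r) * r ^ (-1 - β)
  set FR := ∫ r in h..(b - x), (U x - U (x + r)) * Real.exp (-lam * r) * r ^ (-1 - β)
  set C := 4 * K * (1 + lam) * (b - a) ^ (1 - β)
        + 2 * (K * (1 + lam) ^ 2 * ((b - a) ^ (1 - β) / (1 - β)))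
  have hlim : Tendsto (fun ε : ℝ => C * h ^ 2 + c * ε ^ (2 - β)) (nhdsWithin 0 (Ioi 0))
      (nhds (C * h ^ 2)) := by
    have : Tendsto (fun ε : ℝ => C * h ^ 2 + c * ε ^ (2 - β)) (nhds 0)
        (nhds (C * h ^ 2 + c * 0 ^ (2 - β))) :=
      ((Real.continuousAt_rpow_const 0 (2 - β) (Or.inr (by linarith))).tendsto.const_mul c).const_add _
    rw [Real.zero_rpow (by linarith), mul_zero, add_zero] at this
    exact this.mono_left nhdsWithin_le_nhds
  refine le_of_tendsto_of_tendsto ((hf.sub_const _).abs) hlim ?_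
  filter_upwards [Ioo_mem_nhdsGT hh] with ε hε
  have near := abs_singular_cell_error_le hβ1 h1 h2 h3 hlam hK2 hK3 hh (x := x) (by linarith)
    (by linarith) hε.1 hε.2.le
  rw [truncated_integral_eq hβ hlam hg hug hgint cU hUu hε.1 (by linarith [hε.2])
    (by linarith [hε.2])]
  have ii : ∀ s t : ℝ, 0 < s → 0 < t → ∀ σ : ℝ, IntervalIntegrable
      (fun r => (U x - U (x + σ * r)) * Real.exp (-lam * r) * r ^ (-1 - β)) volume s t := by
    intro s t hs ht σ
    have hsub : uIcc s t ⊆ Ioi 0 := fun r hr => (lt_inf_iff.2 ⟨hs, ht⟩).trans_le hr.1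
    have := continuousOn_rpow_const_of_subset_Ioi hsub (-1 - β)
    exact ContinuousOn.intervalIntegrable (by fun_prop)
  have iiL : ∀ s t : ℝ, 0 < s → 0 < t → IntervalIntegrable
      (fun r => (U x - U (x - r)) * Real.exp (-lam * r) * r ^ (-1 - β)) volume s t := by
    intro s t hs ht
    simpa [sub_eq_add_neg] using ii s t hs ht (-1)
  have iiR : ∀ s t : ℝ, 0 < s → 0 < t → IntervalIntegrable
      (fun r => (U x - U (x + r)) * Real.exp (-lam * r) * r ^ (-1 - β)) volume s t := by
    intro s t hs ht
    simpa using ii s t hs ht 1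
  have hxa0 : 0 < x - a := by linarith
  have hxb0 : 0 < b - x := by linarith
  have sL := intervalIntegral.integral_add_adjacent_intervals (iiL ε h hε.1 hh) (iiL h _ hh hxa0)
  have sR := intervalIntegral.integral_add_adjacent_intervals (iiR ε h hε.1 hh) (iiR h _ hh hxb0)
  have sN : ∫ t in ε..h, (2 * U x - U (x - t) - U (x + t)) * Real.exp (-lam * t) * t ^ (-1 - β)
      = (∫ r in ε..h, (U x - U (x - r)) * Real.exp (-lam * r) * r ^ (-1 - β))
        + ∫ r in ε..h, (U x - U (x + r)) * Real.exp (-lam * r) * r ^ (-1 - β) := by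
    rw [← intervalIntegral.integral_add (iiL ε h hε.1 hh) (iiR ε h hε.1 hh)]
    congr 1; ext r; ring
  rw [sN] at near
  rw [← sL, ← sR]
  set NL := ∫ r in ε..h, (U x - U (x - r)) * Real.exp (-lam * r) * r ^ (-1 - β)
  set NR := ∫ r in ε..h, (U x - U (x + r)) * Real.exp (-lam * r) * r ^ (-1 - β)
  have e2 : G + (NL + FL) + (NR + FR) - (G + (W * (U x - U (x - h)) + SL)
        + (W * (U x - U (x + h)) + SR))
      = (NL + NR - W * (2 * U x - U (x - h) - U (x + h))) + (FL - SL) + (FR - SR) := by ring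
  rw [e2]
  calc _ ≤ _ := abs_add_three _ _ _
    _ ≤ (4 * K * (1 + lam) * h ^ 2 * h ^ (1 - β) + c * ε ^ (2 - β))
        + K * (1 + lam) ^ 2 * h ^ 2 * ((x - a) ^ (1 - β) / (1 - β))
        + K * (1 + lam) ^ 2 * h ^ 2 * ((b - x) ^ (1 - β) / (1 - β)) :=
      add_le_add (add_le_add near farL) farR
    _ ≤ (4 * K * (1 + lam) * h ^ 2 * (b - a) ^ (1 - β) + c * ε ^ (2 - β))
        + K * (1 + lam) ^ 2 * h ^ 2 * ((b - a) ^ (1 - β) / (1 - β))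
        + K * (1 + lam) ^ 2 * h ^ 2 * ((b - a) ^ (1 - β) / (1 - β)) := by
      have r1 := rpow_mono hh.le (by linarith)
      have r2 := rpow_mono hxa0.le (by linarith)
      have r3 := rpow_mono hxb0.le (by linarith)
      gcongr
    _ = _ := by simp only [C]; ring

section Grid

variable {a b β lam : ℝ} {M : ℕ}

theorem gH_pos (hab : a < b) : 0 < gH a b M := div_pos (sub_pos.2 hab) (by positivity)

theorem cA1_eq (i k d : ℕ) (hi : i = k + 1 + d) :
    cA1 a b β 1 M i (k + 1) = farNodeWeight (gH a b M) β d := by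
  subst hi
  have := intervalIntegral.integral_comp_sub_left (a := gX a b M k) (b := gX a b M (k + 1))
    (fun r => (r - d * gH a b M) * r ^ (-β)) (gX a b M (k + 1 + d))
  have e1 : gX a b M (k + 1 + d) - gX a b M (k + 1) = d * gH a b M := by
    simp only [gX]; push_cast; ring
  have e2 : gX a b M (k + 1 + d) - gX a b M k = (d + 1) * gH a b M := by
    simp only [gX]; push_cast; ring
  rw [e1, e2] at this
  simp only [cA1, farNodeWeight, Nat.cast_one, Nat.add_sub_cancel, sub_self, zero_sub]
  rw [← this]
  congr 2; ext y
  rw [← e1]; congr 1; ring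

theorem cA2_eq (i k d : ℕ) (hi : i = k + 1 + d) :
    cA2 a b β 1 M i (k + 1) = nearNodeWeight (gH a b M) β d := by
  subst hi
  have := intervalIntegral.integral_comp_sub_left (a := gX a b M k) (b := gX a b M (k + 1))
    (fun r => ((d + 1) * gH a b M - r) * r ^ (-β)) (gX a b M (k + 1 + d))
  have e1 : gX a b M (k + 1 + d) - gX a b M (k + 1) = d * gH a b M := by
    simp only [gX]; push_cast; ring
  have e2 : gX a b M (k + 1 + d) - gX a b M k = (d + 1) * gH a b M := by
    simp only [gX]; push_cast; ring
  rw [e1, e2] at this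
  simp only [cA2, nearNodeWeight, Nat.cast_one, Nat.add_sub_cancel, sub_self, zero_sub]
  rw [← this]
  congr 2; ext y
  rw [← e2]; congr 1; ring

theorem cA3_eq (i k d : ℕ) (hk : k = i + d) :
    cA3 a b β 1 M i (k + 1) = nearNodeWeight (gH a b M) β d := by
  subst hk
  have := intervalIntegral.integral_comp_sub_right (a := gX a b M (i + d))
    (b := gX a b M (i + d + 1)) (fun r => ((d + 1) * gH a b M - r) * r ^ (-β)) (gX a b M i)
  have e1 : gX a b M (i + d) - gX a b M i = d * gH a b M := by
    simp only [gX]; push_cast; ring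
  have e2 : gX a b M (i + d + 1) - gX a b M i = (d + 1) * gH a b M := by
    simp only [gX]; push_cast; ring
  rw [e1, e2] at this
  simp only [cA3, nearNodeWeight, Nat.cast_one, Nat.add_sub_cancel, sub_self, zero_sub]
  rw [← this]
  congr 2; ext y
  rw [← e2]; congr 1; ring

theorem cA4_eq (i k d : ℕ) (hk : k = i + d) :
    cA4 a b β 1 M i (k + 1) = farNodeWeight (gH a b M) β d := by
  subst hk
  have := intervalIntegral.integral_comp_sub_right (a := gX a b M (i + d))
    (b := gX a b M (i + d + 1)) (fun r => (r - d * gH a b M) * r ^ (-β)) (gX a b M i)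
  have e1 : gX a b M (i + d) - gX a b M i = d * gH a b M := by
    simp only [gX]; push_cast; ring
  have e2 : gX a b M (i + d + 1) - gX a b M i = (d + 1) * gH a b M := by
    simp only [gX]; push_cast; ring
  rw [e1, e2] at this
  simp only [cA4, farNodeWeight, Nat.cast_one, Nat.add_sub_cancel, sub_self, zero_sub]
  rw [← this]
  congr 2; ext y
  rw [← e1]; congr 1; ring

theorem offD_self (i : ℕ) : offD a b β lam 1 1 M i i = 0 := by simp [offD]

theorem offD_left (i j l : ℕ) (hi : i = j + 1 + (l + 1)) :
    offD a b β lam 1 1 M i (j + 1) = -nodeWeight (gH a b M) β lam (l + 1) := by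
  have hc : (i : ℝ) - ((j + 1 : ℕ) : ℝ) = ((l + 1 : ℕ) : ℝ) := by subst hi; push_cast; ring
  rcases l with _ | l
  · have e : i - 1 = j + 1 := by omega
    rw [offD, if_neg (by omega), if_pos (by omega), e, cA2_eq i j 1 (by omega)]
    simp [nodeWeight, endWeight, singularWeight]
    ring
  · rw [offD, if_pos (by omega), hc, cA1_eq i (j + 1) (l + 1) (by omega),
      cA2_eq i j (l + 1 + 1) (by omega), Nat.cast_one, Real.rpow_neg_one]
    simp only [nodeWeight, endWeight, if_neg (show l + 1 + 1 ≠ 1 by omega), Nat.add_sub_cancel]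
    ring

theorem offD_right (i j l : ℕ) (hj : j = i + (l + 1)) :
    offD a b β lam 1 1 M i j = -nodeWeight (gH a b M) β lam (l + 1) := by
  have hc : (j : ℝ) - (i : ℝ) = ((l + 1 : ℕ) : ℝ) := by subst hj; push_cast; ring
  rcases l with _ | l
  · rw [offD, if_neg (by omega), if_neg (by omega), if_pos (by omega),
      cA3_eq i (i + 1) 1 (by omega)]
    simp [nodeWeight, endWeight, singularWeight]
    ring
  · have e : j = i + (l + 1) + 1 := by omega
    rw [offD, if_neg (by omega), if_neg (by omega), if_neg (by omega), if_pos (by omega), hc,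
      cA3_eq i j (l + 1 + 1) (by omega), e, cA4_eq i (i + (l + 1)) (l + 1) rfl, Nat.cast_one,
      Real.rpow_neg_one]
    simp only [nodeWeight, endWeight, if_neg (show l + 1 + 1 ≠ 1 by omega), Nat.add_sub_cancel]
    ring

theorem diagExtra_eq (hM : 3 ≤ M) (n m : ℕ) (hnm : n + 1 + m = M) :
    diagExtra a b β lam 1 1 M (n + 1) =
      endWeight (gH a b M) β lam (n + 1) + endWeight (gH a b M) β lam (m + 1) := by
  have hcm : (M : ℝ) + 1 - ((n + 1 : ℕ) : ℝ) = ((m + 1 : ℕ) : ℝ) := by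
    rw [← hnm]; push_cast; ring
  rcases n with _ | n
  · have e : m + 1 = M := by omega
    rw [diagExtra, if_pos rfl, cA4_eq 1 M (M - 1) (by omega), e, endWeight, endWeight,
      if_pos rfl, if_neg (by omega)]
    simp [singularWeight, Real.rpow_neg_one]
  · rcases m with _ | m
    · have e : n + 1 + 1 = M := by omega
      rw [diagExtra, if_neg (by omega), if_pos e, cA1_eq M 0 (M - 1) (by omega), e, endWeight,
        endWeight, if_neg (by omega), if_pos rfl]
      simp [singularWeight, Real.rpow_neg_one]
      ring
    · rw [diagExtra, if_neg (by omega), if_neg (by omega), hcm,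
        cA1_eq (n + 1 + 1) 0 (n + 1) (by omega),
        cA4_eq (n + 1 + 1) M (m + 1) (by omega), endWeight, endWeight, if_neg (by omega),
        if_neg (by omega), Nat.cast_one, Real.rpow_neg_one, Real.rpow_neg_one]
      simp only [Nat.add_sub_cancel]

theorem loadF_eq (f g u : ℝ → ℝ) (i : Fin M) (m : ℕ) (hnm : i.val + 1 + m = M) :
    loadF a b β lam 1 1 f g u M i =
      f (gX a b M (i.val + 1)) + dd1 a b β lam g M (i.val + 1) + dd2 a b β lam g M (i.val + 1)
        + endWeight (gH a b M) β lam (i.val + 1) * u a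
        + endWeight (gH a b M) β lam (m + 1) * u b := by
  have hcm : (M : ℝ) - (i.val : ℝ) = ((m + 1 : ℕ) : ℝ) := by
    have : (i.val : ℝ) + 1 + m = M := by exact_mod_cast hnm
    push_cast; linarith
  have e1 : (if i.val + 1 = 1 then
        gH a b M ^ (-β) * Real.exp (-lam * gH a b M) / (((1 : ℕ) : ℝ) + 1 - β)
      else cA1 a b β 1 M (i.val + 1) 1 * Real.exp (-lam * ((i.val : ℝ) + 1) * gH a b M) *
          ((i.val : ℝ) + 1) ^ (-((1 : ℕ) : ℝ))) = endWeight (gH a b M) β lam (i.val + 1) := by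
    rw [endWeight]
    split_ifs with h
    · simp [singularWeight]
    · rw [cA1_eq (i.val + 1) 0 i.val (by omega), Nat.cast_one, Real.rpow_neg_one]
      simp
  have e2 : (if i.val + 1 = M then
        gH a b M ^ (-β) * Real.exp (-lam * gH a b M) / (((1 : ℕ) : ℝ) + 1 - β)
      else cA4 a b β 1 M (i.val + 1) (M + 1) * Real.exp (-lam * ((M : ℝ) - i.val) * gH a b M) *
          ((M : ℝ) - (i.val : ℝ)) ^ (-((1 : ℕ) : ℝ))) = endWeight (gH a b M) β lam (m + 1) := by
    rw [endWeight]
    by_cases h : m = 0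
    · rw [if_pos (by omega), if_pos (by omega)]
      simp [singularWeight]
    · rw [if_neg (by omega), if_neg (by omega), hcm, cA4_eq (i.val + 1) M m (by omega),
        Nat.cast_one, Real.rpow_neg_one]
      simp
  rw [loadF, e1, e2]

theorem nearNodeWeight_nonneg {h : ℝ} (hh : 0 < h) (l : ℕ) : 0 ≤ nearNodeWeight h β l := by
  refine mul_nonneg (Real.rpow_nonneg hh.le _)
    (intervalIntegral.integral_nonneg (by gcongr; linarith) fun r hr => ?_)
  have : 0 ≤ r := le_trans (by positivity) hr.1
  exact mul_nonneg (sub_nonneg.2 hr.2) (Real.rpow_nonneg this _)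

theorem farNodeWeight_nonneg {h : ℝ} (hh : 0 < h) (l : ℕ) : 0 ≤ farNodeWeight h β l := by
  refine mul_nonneg (Real.rpow_nonneg hh.le _)
    (intervalIntegral.integral_nonneg (by gcongr; linarith) fun r hr => ?_)
  have : 0 ≤ r := le_trans (by positivity) hr.1
  exact mul_nonneg (sub_nonneg.2 hr.1) (Real.rpow_nonneg this _)

theorem endWeight_nonneg {h : ℝ} (hβ : β < 1) (hh : 0 < h) (l : ℕ) :
    0 ≤ endWeight h β lam l := by
  rw [endWeight]
  split_ifs
  · have : 0 < 1 + 1 - β := by linarith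
    unfold singularWeight
    positivity
  · have := farNodeWeight_nonneg (β := β) hh (l - 1)
    positivity

theorem nodeWeight_nonneg {h : ℝ} (hβ : β < 1) (hh : 0 < h) (l : ℕ) :
    0 ≤ nodeWeight h β lam l := by
  have h1 := endWeight_nonneg (lam := lam) hβ hh l
  have h2 := nearNodeWeight_nonneg (β := β) hh l
  unfold nodeWeight
  positivity

theorem offD_nonpos (hab : a < b) (hβ : β < 1) (i j : ℕ) :
    offD a b β lam 1 1 M i (j + 1) ≤ 0 := by
  rcases lt_trichotomy (j + 1) i with h | h | h
  · rw [offD_left i j (i - (j + 1) - 1) (by omega)]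
    exact neg_nonpos.2 (nodeWeight_nonneg hβ (gH_pos hab) _)
  · rw [h, offD_self]
  · rw [offD_right i (j + 1) (j + 1 - i - 1) (by omega)]
    exact neg_nonpos.2 (nodeWeight_nonneg hβ (gH_pos hab) _)

theorem gX_mem_Ioo (hab : a < b) (i : Fin M) : gX a b M (i.val + 1) ∈ Ioo a b := by
  have hh : 0 < gH a b M := gH_pos hab
  have hi : ((i.val + 1 : ℕ) : ℝ) < M + 1 := by exact_mod_cast Nat.succ_lt_succ i.isLt
  have hb : a + (M + 1) * gH a b M = b := by
    have : (M : ℝ) + 1 ≠ 0 := by positivity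
    rw [gH, mul_div_cancel₀ _ this]; ring
  refine ⟨?_, ?_⟩
  · have : 0 < ((i.val + 1 : ℕ) : ℝ) * gH a b M := by positivity
    unfold gX; linarith
  · have := mul_lt_mul_of_pos_right hi hh
    unfold gX; linarith

theorem le_cB1 (hab : a < b) (hβ : 0 < β) (hlam : 0 ≤ lam) (i : Fin M) :
    Real.exp (-lam * (b - a + 1)) * (b - a + 1) ^ (-1 - β) ≤ cB1 a b β lam M (i.val + 1) := by
  obtain ⟨h1, h2⟩ := gX_mem_Ioo hab i
  unfold cB1
  set x := gX a b M (i.val + 1)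
  have hint : IntegrableOn (fun y => Real.exp (lam * (y - x)) * (x - y) ^ (-1 - β)) (Iio a) := by
    refine (integrableOn_tempered_kernel_Iio hβ hlam h1).congr_fun (fun y hy => ?_)
      measurableSet_Iio
    have : 0 < x - y := by linarith [mem_Iio.1 hy]
    simp only [abs_of_pos this]; congr 2; ring
  have hnn : ∀ y ∈ Iio a, 0 ≤ Real.exp (lam * (y - x)) * (x - y) ^ (-1 - β) := fun y hy =>
    mul_nonneg (Real.exp_pos _).le (Real.rpow_nonneg (by linarith [mem_Iio.1 hy]) _)
  calc _ = ∫ _ in Ioo (a - 1) a, Real.exp (-lam * (b - a + 1)) * (b - a + 1) ^ (-1 - β) := by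
        simp
    _ ≤ ∫ y in Ioo (a - 1) a, Real.exp (lam * (y - x)) * (x - y) ^ (-1 - β) := by
        refine setIntegral_mono_on (integrableOn_const (by simp)) (hint.mono_set fun y hy => hy.2) measurableSet_Ioo
          fun y hy => ?_
        have p1 : 0 < x - y := by linarith [hy.2]
        have p2 : x - y ≤ b - a + 1 := by linarith [hy.1]
        have p3 : (b - a + 1) ^ (-1 - β) ≤ (x - y) ^ (-1 - β) :=
          Real.rpow_le_rpow_of_nonpos p1 p2 (by linarith)
        have p4 : Real.exp (-lam * (b - a + 1)) ≤ Real.exp (lam * (y - x)) :=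
          Real.exp_le_exp.2 (by nlinarith)
        have p5 : 0 ≤ (b - a + 1) ^ (-1 - β) := Real.rpow_nonneg (by linarith) _
        exact mul_le_mul p4 p3 p5 (Real.exp_pos _).le
    _ ≤ _ := setIntegral_mono_set hint
        ((ae_restrict_iff' measurableSet_Iio).2 (Filter.Eventually.of_forall hnn))
        (Filter.Eventually.of_forall fun y (hy : y ∈ Ioo (a - 1) a) => hy.2)

theorem cB2_nonneg (hab : a < b) (i : Fin M) : 0 ≤ cB2 a b β lam M (i.val + 1) := by
  obtain ⟨-, h2⟩ := gX_mem_Ioo hab i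
  exact setIntegral_nonneg measurableSet_Ioi fun y hy =>
    mul_nonneg (Real.exp_pos _).le (Real.rpow_nonneg (by linarith [mem_Ioi.1 hy]) _)

theorem stiff_mulVec_apply (v : Fin M → ℝ) (i : Fin M) :
    (stiff a b β lam 1 1 M).mulVec v i =
      (cB1 a b β lam M (i.val + 1) + cB2 a b β lam M (i.val + 1)
        + diagExtra a b β lam 1 1 M (i.val + 1)) * v i
      - ∑ k : Fin M, offD a b β lam 1 1 M (i.val + 1) (k.val + 1) * (v i - v k) := by
  rw [Matrix.mulVec, dotProduct, ← Finset.add_sum_erase _ _ (Finset.mem_univ i),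
    ← Finset.add_sum_erase _ (fun k : Fin M => offD a b β lam 1 1 M (i.val + 1) (k.val + 1)
      * (v i - v k)) (Finset.mem_univ i)]
  have : ∑ k ∈ Finset.univ.erase i, stiff a b β lam 1 1 M i k * v k
      = ∑ k ∈ Finset.univ.erase i, offD a b β lam 1 1 M (i.val + 1) (k.val + 1) * v k := by
    refine Finset.sum_congr rfl fun k hk => ?_
    rw [stiff, if_neg (Finset.ne_of_mem_erase hk).symm]
  rw [this, stiff, if_pos rfl]
  simp only [mul_sub, Finset.sum_sub_distrib, ← Finset.sum_mul]
  ring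

/-- The stiffness matrix is stable in the maximum norm. -/
theorem abs_le_of_abs_stiff_mulVec_le (hM : 3 ≤ M) (hab : a < b) (hβ : 0 < β) (hβ1 : β < 1)
    (hlam : 0 ≤ lam) {v : Fin M → ℝ} {R : ℝ}
    (hR : ∀ i, |(stiff a b β lam 1 1 M).mulVec v i| ≤ R) (i : Fin M) :
    |v i| ≤ R / (Real.exp (-lam * (b - a + 1)) * (b - a + 1) ^ (-1 - β)) := by
  have : Nonempty (Fin M) := ⟨i⟩
  obtain ⟨j, hj⟩ := Finite.exists_max fun k => |v k|
  refine (hj i).trans ?_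
  set c := Real.exp (-lam * (b - a + 1)) * (b - a + 1) ^ (-1 - β) with hc
  have hc0 : 0 < c := mul_pos (Real.exp_pos _) (Real.rpow_pos_of_pos (by linarith) _)
  rw [le_div_iff₀ hc0]
  have hR0 : 0 ≤ R := (abs_nonneg _).trans (hR j)
  have hex : 0 ≤ diagExtra a b β lam 1 1 M (j.val + 1) := by
    rw [diagExtra_eq hM j.val (M - 1 - j.val) (by omega)]
    exact add_nonneg (endWeight_nonneg hβ1 (gH_pos hab) _) (endWeight_nonneg hβ1 (gH_pos hab) _)
  have hsum : ∑ k : Fin M, v j * (offD a b β lam 1 1 M (j.val + 1) (k.val + 1) * (v j - v k))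
      ≤ 0 := by
    refine Finset.sum_nonpos fun k _ => ?_
    have h1 : v j * v k ≤ v j * v j := by
      calc v j * v k ≤ |v j| * |v k| := by rw [← abs_mul]; exact le_abs_self _
        _ ≤ |v j| * |v j| := mul_le_mul_of_nonneg_left (hj k) (abs_nonneg _)
        _ = v j * v j := abs_mul_abs_self _
    have h2 := offD_nonpos (lam := lam) (M := M) hab hβ1 (j.val + 1) k.val
    nlinarith
  have hmain : c * (v j * v j) ≤ v j * (stiff a b β lam 1 1 M).mulVec v j := by
    rw [stiff_mulVec_apply, mul_sub, Finset.mul_sum]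
    have := le_cB1 (M := M) hab hβ hlam j
    have := cB2_nonneg (β := β) (lam := lam) hab j
    have hsq := mul_self_nonneg (v j)
    have : c * (v j * v j) ≤ (cB1 a b β lam M (j.val + 1) + cB2 a b β lam M (j.val + 1)
        + diagExtra a b β lam 1 1 M (j.val + 1)) * (v j * v j) := by
      gcongr; linarith
    linarith
  have hup : v j * (stiff a b β lam 1 1 M).mulVec v j ≤ |v j| * R := by
    refine (le_abs_self _).trans ?_
    rw [abs_mul]; gcongr; exact hR j
  rw [← abs_mul_abs_self (v j)] at hmain
  rcases (abs_nonneg (v j)).eq_or_lt with h0 | h0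
  · rw [← h0, zero_mul]; exact hR0
  · refine le_of_mul_le_mul_left ?_ h0
    linarith

theorem stiff_existsUnique (hM : 3 ≤ M) (hab : a < b) (hβ : 0 < β) (hβ1 : β < 1)
    (hlam : 0 ≤ lam) (F : Fin M → ℝ) :
    ∃! v : Fin M → ℝ, (stiff a b β lam 1 1 M).mulVec v = F := by
  have hinj : Function.Injective (stiff a b β lam 1 1 M).mulVecLin := by
    refine (injective_iff_map_eq_zero _).2 fun v hv => funext fun i => ?_
    have := abs_le_of_abs_stiff_mulVec_le hM hab hβ hβ1 hlam (v := v) (R := 0) (fun i => by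
      have := congrFun hv i
      rw [Matrix.mulVecLin_apply] at this
      rw [this]; simp) i
    rw [zero_div] at this
    exact abs_nonpos_iff.1 this
  have hbij : Function.Bijective (stiff a b β lam 1 1 M).mulVecLin :=
    ⟨hinj, LinearMap.injective_iff_surjective.1 hinj⟩
  exact hbij.existsUnique F

theorem sum_offD_eq (φ : ℝ → ℝ) (n m : ℕ) (hnm : n + 1 + m = M) :
    ∑ k : Fin M, offD a b β lam 1 1 M (n + 1) (k.val + 1)
        * (φ (gX a b M (n + 1)) - φ (gX a b M (k.val + 1))) =
      -(∑ l ∈ Finset.range n, nodeWeight (gH a b M) β lam (l + 1)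
          * (φ (gX a b M (n + 1)) - φ (gX a b M (n + 1) - (l + 1 : ℕ) * gH a b M))
        + ∑ l ∈ Finset.range m, nodeWeight (gH a b M) β lam (l + 1)
          * (φ (gX a b M (n + 1)) - φ (gX a b M (n + 1) + (l + 1 : ℕ) * gH a b M))) := by
  rw [Fin.sum_univ_eq_sum_range (fun k => offD a b β lam 1 1 M (n + 1) (k + 1)
        * (φ (gX a b M (n + 1)) - φ (gX a b M (k + 1)))) M]
  conv_lhs => rw [← hnm, Finset.sum_range_add, Finset.sum_range_succ, hnm]
  rw [offD_self, zero_mul, add_zero, neg_add, ← Finset.sum_neg_distrib, ← Finset.sum_neg_distrib,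
    ← Finset.sum_range_reflect]
  congr 1
  · refine Finset.sum_congr rfl fun l hl => ?_
    have hl' := Finset.mem_range.1 hl
    obtain ⟨k, rfl⟩ : ∃ k, n = l + 1 + k := ⟨n - l - 1, by omega⟩
    have e : l + 1 + k - 1 - l = k := by omega
    rw [e, offD_left _ k l (by omega)]
    have : gX a b M (k + 1) = gX a b M (l + 1 + k + 1) - (l + 1 : ℕ) * gH a b M := by
      simp only [gX]; push_cast; ring
    rw [this]; ring
  · refine Finset.sum_congr rfl fun l hl => ?_
    rw [offD_right _ (n + 1 + l + 1) l (by omega)]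
    have : gX a b M (n + 1 + l + 1) = gX a b M (n + 1) + (l + 1 : ℕ) * gH a b M := by
      simp only [gX]; push_cast; ring
    rw [this]; ring

end Grid

theorem dnorm2_le {a b : ℝ} (hab : a < b) {M : ℕ} {v : Fin M → ℝ} {c : ℝ} (hc : 0 ≤ c)
    (hv : ∀ i, |v i| ≤ c) : dnorm2 a b M v ≤ Real.sqrt (b - a) * c := by
  have hh : 0 < gH a b M := gH_pos hab
  rw [dnorm2, Real.sqrt_le_left (by positivity), mul_pow, Real.sq_sqrt (by linarith)]
  calc gH a b M * ∑ i, v i ^ 2 ≤ gH a b M * ∑ i : Fin M, c ^ 2 := by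
        refine mul_le_mul_of_nonneg_left (Finset.sum_le_sum fun i _ => ?_) hh.le
        exact sq_le_sq' (abs_le.1 (hv i)).1 (abs_le.1 (hv i)).2
    _ = M * gH a b M * c ^ 2 := by simp; ring
    _ ≤ (b - a) * c ^ 2 := by
        gcongr
        have : (M : ℝ) + 1 ≠ 0 := by positivity
        have : ((M : ℝ) + 1) * gH a b M = b - a := by rw [gH, mul_div_cancel₀ _ this]
        linarith

/-- convergence of the finite difference scheme, case `β ∈ (0,1)`, `s = s₁ = 1`,
`u ∈ C³([a,b])`: there are constants `C₁, C₂ > 0`, independent of `M` and `h`, such that for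
every `M ≥ 3` the system `H U_h = F` has a unique solution `U_h`, with
`‖U − U_h‖ ≤ C₁ h²` and `‖U − U_h‖_∞ ≤ C₂ h²`. -/
theorem scheme_convergence_C3_second_order (a b β lam : ℝ)
    (hab : a < b) (hβ : β ∈ Set.Ioo (0 : ℝ) 1) (hlam : 0 ≤ lam)
    (u g f : ℝ → ℝ)
    (hu : ContDiffOn ℝ 3 u (Set.Icc a b))
    (hg : Measurable g)
    (hug : ∀ x, x ∉ Set.Ioo a b → u x = g x)
    (hgint : ∀ x ∈ Set.Ioo a b,
      IntegrableOn (fun y => |g y| * Real.exp (-lam * |x - y|) * |x - y| ^ (-1 - β))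
        (Set.Ioo a b)ᶜ volume)
    (hf : ∀ x ∈ Set.Ioo a b,
      Filter.Tendsto
        (fun ε : ℝ => ∫ y in {y : ℝ | ε < |x - y|},
          (u x - u y) * Real.exp (-lam * |x - y|) * |x - y| ^ (-1 - β))
        (nhdsWithin 0 (Set.Ioi 0)) (nhds (f x))) :
    ∃ C₁ > (0 : ℝ), ∃ C₂ > (0 : ℝ), ∀ M : ℕ, 3 ≤ M →
      (∃! Uh : Fin M → ℝ,
        (stiff a b β lam 1 1 M).mulVec Uh = loadF a b β lam 1 1 f g u M) ∧
      ∀ Uh : Fin M → ℝ,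
        (stiff a b β lam 1 1 M).mulVec Uh = loadF a b β lam 1 1 f g u M →
          dnorm2 a b M (fun i => u (gX a b M (i.val + 1)) - Uh i)
              ≤ C₁ * gH a b M ^ 2 ∧
            ∀ i : Fin M, |u (gX a b M (i.val + 1)) - Uh i| ≤ C₂ * gH a b M ^ 2 := by
  obtain ⟨hβ0, hβ1⟩ := hβ
  obtain ⟨U, U₁, U₂, U₃, h1, h2, h3, hU₃, hUu⟩ := exists_C3_extension hab hu
  have cont : ∀ {q q' : ℝ → ℝ}, (∀ x, HasDerivAt q (q' x) x) → Continuous q := fun hq =>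
    continuous_iff_continuousAt.2 fun x => (hq x).continuousAt
  obtain ⟨K₁, hK₁⟩ := isCompact_Icc.exists_bound_of_continuousOn (cont h2).continuousOn
    (s := Icc a b)
  obtain ⟨K₂, hK₂⟩ := isCompact_Icc.exists_bound_of_continuousOn (cont h3).continuousOn
    (s := Icc a b)
  obtain ⟨K₃, hK₃⟩ := isCompact_Icc.exists_bound_of_continuousOn hU₃.continuousOn
    (s := Icc a b)
  set K := max 1 (max K₁ (max K₂ K₃)) with hK
  have hK0 : 0 < K := lt_max_of_lt_left one_pos
  have l1 : K₁ ≤ K := (le_max_left _ _).trans (le_max_right _ _)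
  have l2 : K₂ ≤ K := (le_max_left _ _).trans ((le_max_right _ _).trans (le_max_right _ _))
  have l3 : K₃ ≤ K := (le_max_right _ _).trans ((le_max_right _ _).trans (le_max_right _ _))
  set C := 4 * K * (1 + lam) * (b - a) ^ (1 - β)
        + 2 * (K * (1 + lam) ^ 2 * ((b - a) ^ (1 - β) / (1 - β))) with hC
  set c := Real.exp (-lam * (b - a + 1)) * (b - a + 1) ^ (-1 - β) with hc
  have hba : 0 < b - a := sub_pos.2 hab
  have h1β : 0 < 1 - β := by linarith
  have hc0 : 0 < c := mul_pos (Real.exp_pos _) (Real.rpow_pos_of_pos (by linarith) _)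
  have hC0 : 0 < C := by positivity
  refine ⟨Real.sqrt (b - a) * (C / c), by positivity, C / c, by positivity, fun M hM =>
    ⟨stiff_existsUnique hM hab hβ0 hβ1 hlam _, fun Uh hUh => ?_⟩⟩
  have hh : 0 < gH a b M := gH_pos hab
  have hbound : ∀ i : Fin M, |u (gX a b M (i.val + 1)) - Uh i| ≤ C / c * gH a b M ^ 2 := by
    have := abs_le_of_abs_stiff_mulVec_le hM hab hβ0 hβ1 hlam
      (v := (fun i : Fin M => u (gX a b M (i.val + 1))) - Uh) (R := C * gH a b M ^ 2) (fun i => ?_)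
    · intro i
      rw [div_mul_eq_mul_div]
      exact this i
    · rw [Matrix.mulVec_sub, hUh, Pi.sub_apply, stiff_mulVec_apply]
      obtain ⟨m, hm⟩ : ∃ m, i.val + 1 + m = M := ⟨M - (i.val + 1), by omega⟩
      have hx := gX_mem_Ioo hab i
      have hxa : gX a b M (i.val + 1) - a = ((i.val : ℝ) + 1) * gH a b M := by
        simp only [gX]; push_cast; ring
      have hxb : b - gX a b M (i.val + 1) = ((m : ℝ) + 1) * gH a b M := by
        have : (M : ℝ) + 1 ≠ 0 := by positivity
        have e : ((M : ℝ) + 1) * gH a b M = b - a := by rw [gH, mul_div_cancel₀ _ this]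
        have hm' : (i.val : ℝ) + 1 + m = M := by exact_mod_cast hm
        rw [← hm'] at e
        simp only [gX]; push_cast; linarith
      have key := abs_truncation_error_le hβ0 hβ1 hlam hg hug (hgint _ hx) h1 h2 h3 hUu
        (fun x hx => (hK₁ x hx).trans l1) (fun x hx => (hK₂ x hx).trans l2)
        (fun x hx => (hK₃ x hx).trans l3) hh i.val m hxa hxb (hf _ hx)
      have ea : gX a b M (i.val + 1) - (i.val + 1 : ℕ) * gH a b M = a := by
        push_cast; linarith
      have eb : gX a b M (i.val + 1) + (m + 1 : ℕ) * gH a b M = b := by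
        push_cast; linarith
      have hsum := sum_offD_eq (a := a) (b := b) (β := β) (lam := lam) U i.val m hm
      have hsum' : ∑ k : Fin M, offD a b β lam 1 1 M (i.val + 1) (k.val + 1)
          * (u (gX a b M (i.val + 1)) - u (gX a b M (k.val + 1)))
          = ∑ k : Fin M, offD a b β lam 1 1 M (i.val + 1) (k.val + 1)
          * (U (gX a b M (i.val + 1)) - U (gX a b M (k.val + 1))) :=
        Finset.sum_congr rfl fun k _ => by
          rw [hUu (Ioo_subset_Icc_self hx), hUu (Ioo_subset_Icc_self (gX_mem_Ioo hab k))]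
      rw [ea, eb] at key
      rw [hsum', hsum, loadF_eq f g u i m hm, diagExtra_eq hM i.val m hm]
      rw [hUu (left_mem_Icc.2 hab.le), hUu (right_mem_Icc.2 hab.le)] at key
      rw [abs_sub_comm] at key
      refine le_trans (le_of_eq ?_) key
      congr 1
      rw [hUu (Ioo_subset_Icc_self hx)]
      simp only [cB1, cB2, dd1, dd2]
      ring
  refine ⟨?_, hbound⟩
  rw [mul_assoc]
  exact dnorm2_le hab (by positivity) hbound

end
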